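/- arXiv:2307.08906 — 3 statements merged into one kernel-verified Lean document; each statement's English description precedes it below -/
import Mathlib

section
/- Let (X,T) be a topological dynamical system. Then the minimal cardinality (an element of ℕ ∪ {∞}) of a finite set F ⊆ C(X) such that the closed linear span of {f ∘ Tⁿ : f ∈ F, n ∈ ℤ} ∪ B_T(X) equals C(X) is equal to the cardinality of the set of ergodic T-invariant Borel probability measures on X (the equality being in ℕ ∪ {∞}). -/
open MeasureTheory

/-- Iterates of a homeomorphism, indexed by natural numbers. -/
def hiterN {X : Type*} [TopologicalSpace X] (T : X ≃ₜ X) : ℕ → (X ≃ₜ X)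
  | 0 => Homeomorph.refl X
  | n + 1 => (hiterN T n).trans T

/-- Iterates of a homeomorphism, indexed by integers. -/
def hiter {X : Type*} [TopologicalSpace X] (T : X ≃ₜ X) : ℤ → (X ≃ₜ X)
  | Int.ofNat n => hiterN T n
  | Int.negSucc n => (hiterN T (n + 1)).symm

/-- The set of all iterates `f ∘ Tⁿ` for `f ∈ F` and `n ∈ ℤ`. -/
def iterSet {X : Type*} [TopologicalSpace X] (T : X ≃ₜ X) (F : Set C(X, ℝ)) :
    Set C(X, ℝ) :=
  {h | ∃ f ∈ F, ∃ n : ℤ, h = f.comp (hiter T n : C(X, X))}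

/-- The set `B_T(X) = {φ ∘ T - φ : φ ∈ C(X)}` of continuous `T`-coboundaries. -/
def cobSet {X : Type*} [TopologicalSpace X] (T : X ≃ₜ X) : Set C(X, ℝ) :=
  {g | ∃ φ : C(X, ℝ), g = φ.comp (T : C(X, X)) - φ}

/-- The minimal cardinality (in `ℕ ∪ {∞}`) of a finite set `F ⊆ C(X)` such that the closed
linear span of `{f ∘ Tⁿ : f ∈ F, n ∈ ℤ} ∪ B_T(X)` is all of `C(X)`. -/
noncomputable def multModCoboundaries {X : Type*} [TopologicalSpace X] (T : X ≃ₜ X) : ℕ∞ :=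
  sInf {c : ℕ∞ | ∃ F : Finset C(X, ℝ), (F.card : ℕ∞) = c ∧
    closure (Submodule.span ℝ (iterSet T (F : Set C(X, ℝ)) ∪ cobSet T) : Set C(X, ℝ))
      = Set.univ}

open Filter Topology ContinuousMap

section Helpers

set_option linter.unusedSectionVars false

variable {X : Type*} [MetricSpace X] [CompactSpace X] [MeasurableSpace X] [BorelSpace X]

theorem cont_integrable (μ : Measure X) [IsFiniteMeasure μ] (f : C(X, ℝ)) :
    Integrable (fun x => f x) μ :=
  (BoundedContinuousFunction.mkOfCompact f).integrable μ

theorem measure_ext_cont {μ ν : Measure X} [IsFiniteMeasure μ] [IsFiniteMeasure ν]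
    (h : ∀ f : C(X, ℝ), ∫ x, f x ∂μ = ∫ x, f x ∂ν) : μ = ν :=
  ext_of_forall_integral_eq_of_IsFiniteMeasure fun f => h f.toContinuousMap

/-- integration as a continuous linear functional -/
noncomputable def intCLM (μ : Measure X) [IsProbabilityMeasure μ] : C(X, ℝ) →L[ℝ] ℝ :=
  LinearMap.mkContinuous
    { toFun := fun f => ∫ x, f x ∂μ
      map_add' := fun f g => integral_add (cont_integrable μ f) (cont_integrable μ g)
      map_smul' := fun c f => integral_const_mul c (fun x => f x) } 1
    (fun f => by
      have := norm_integral_le_of_norm_le_const (μ := μ) (f := fun x => f x) (C := ‖f‖)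
        (Eventually.of_forall fun x => f.norm_coe_le_norm x)
      simpa using this)

theorem intCLM_apply (μ : Measure X) [IsProbabilityMeasure μ] (f : C(X, ℝ)) :
    intCLM μ f = ∫ x, f x ∂μ := rfl

theorem ergodic_singular {T : X → X} {μ ν : Measure X} [IsProbabilityMeasure μ]
    [IsProbabilityMeasure ν] (hμ : Ergodic T μ) (hν : Ergodic T ν) (hne : μ ≠ ν) :
    μ.MutuallySingular ν := by
  have h1 := hμ.toMeasurePreserving.singularPart hν.toMeasurePreserving
  obtain ⟨c, hc⟩ := hμ.eq_smul_of_absolutelyContinuous h1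
    (Measure.absolutelyContinuous_of_le (Measure.singularPart_le μ ν))
  by_cases h0 : c = 0
  · exfalso
    apply hne
    apply hν.eq_of_absolutelyContinuous hμ.toMeasurePreserving
    rw [← Measure.singularPart_eq_zero, hc, h0, zero_smul]
  · have h2 := μ.mutuallySingular_singularPart ν
    rw [hc] at h2
    exact h2.mono_ac (Measure.absolutelyContinuous_smul h0) (Measure.AbsolutelyContinuous.refl ν)

theorem not_pos_of_relation {T : X → X} (t : Finset (Measure X))
    (ht : ∀ μ ∈ t, IsProbabilityMeasure μ ∧ Ergodic T μ) (c : Measure X → ℝ)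
    (h : ∀ g : C(X, ℝ), ∑ μ ∈ t, c μ * ∫ x, g x ∂μ = 0) (μ : Measure X) (hμ : μ ∈ t) :
    c μ ≤ 0 := by
  by_contra hpos
  push Not at hpos
  have hIntSum : ∀ (d : Measure X → ℝ) (g : C(X, ℝ)),
      ∫ x, g x ∂(∑ ν ∈ t, ENNReal.ofReal (d ν) • ν) = ∑ ν ∈ t, max (d ν) 0 * ∫ x, g x ∂ν := by
    intro d g
    rw [integral_finsetSum_measure]
    · refine Finset.sum_congr rfl fun ν hν => ?_
      rw [integral_smul_measure, ENNReal.toReal_ofReal', smul_eq_mul]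
    · intro ν hν
      have := (ht ν hν).1
      exact (cont_integrable ν g).smul_measure ENNReal.ofReal_ne_top
  have hfin : ∀ (d : Measure X → ℝ), IsFiniteMeasure (∑ ν ∈ t, ENNReal.ofReal (d ν) • ν) := by
    intro d
    constructor
    rw [Measure.finsetSum_apply]
    refine ENNReal.sum_lt_top.2 fun ν hν => ?_
    have := (ht ν hν).1
    simp
  have := hfin c
  have := hfin (fun ν => - c ν)
  have heq : (∑ ν ∈ t, ENNReal.ofReal (c ν) • ν) = ∑ ν ∈ t, ENNReal.ofReal (- c ν) • ν := by
    apply measure_ext_cont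
    intro g
    rw [hIntSum c g, hIntSum (fun ν => - c ν) g, ← sub_eq_zero, ← Finset.sum_sub_distrib]
    refine Eq.trans ?_ (h g)
    refine Finset.sum_congr rfl fun ν hν => ?_
    rw [← sub_mul]
    congr 1
    rcases le_total (c ν) 0 with h | h
    · rw [max_eq_right h, max_eq_left (by linarith)]; ring
    · rw [max_eq_left h, max_eq_right (by linarith)]; ring
  have hP := (ht μ hμ).1
  have hs : μ.MutuallySingular (∑ ν ∈ t, ENNReal.ofReal (- c ν) • ν) := by
    have : ∀ s : Finset (Measure X), s ⊆ t →
        μ.MutuallySingular (∑ ν ∈ s, ENNReal.ofReal (- c ν) • ν) := by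
      intro s
      classical
      induction s using Finset.induction_on with
      | empty => intro _; simp
      | insert a s has ih =>
        intro hst
        rw [Finset.sum_insert has]
        have hat := hst (Finset.mem_insert_self a s)
        refine Measure.MutuallySingular.add_right ?_
          (ih fun x hx => hst (Finset.mem_insert_of_mem hx))
        by_cases hne : μ = a
        · subst hne
          rw [ENNReal.ofReal_of_nonpos (by linarith), zero_smul]
          simp
        · have := (ht a hat).1
          exact ((ergodic_singular (ht μ hμ).2 (ht a hat).2 hne).symm.smul _).symm
    exact this t (Finset.Subset.refl _)
  rw [← heq] at hs
  have hac : μ.AbsolutelyContinuous (∑ ν ∈ t, ENNReal.ofReal (c ν) • ν) := by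
    refine (Measure.absolutelyContinuous_smul (c := ENNReal.ofReal (c μ))
      (by simpa using hpos)).trans (Measure.absolutelyContinuous_of_le ?_)
    exact Finset.single_le_sum (f := fun ν : Measure X => ENNReal.ofReal (c ν) • ν)
      (fun _ _ => bot_le) hμ
  have := hs.mono_ac (Measure.AbsolutelyContinuous.refl μ) hac
  rw [Measure.MutuallySingular.self_iff] at this
  exact IsProbabilityMeasure.ne_zero μ this

theorem zero_of_relation {T : X → X} (t : Finset (Measure X))
    (ht : ∀ μ ∈ t, IsProbabilityMeasure μ ∧ Ergodic T μ) (c : Measure X → ℝ)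
    (h : ∀ g : C(X, ℝ), ∑ μ ∈ t, c μ * ∫ x, g x ∂μ = 0) (μ : Measure X) (hμ : μ ∈ t) :
    c μ = 0 := by
  apply le_antisymm (not_pos_of_relation t ht c h μ hμ)
  have := not_pos_of_relation t ht (fun ν => - c ν) (fun g => by simp [h g]) μ hμ
  linarith

theorem integral_hiterN {T : X ≃ₜ X} {μ : Measure X} (hμ : MeasurePreserving T μ μ) (n : ℕ) :
    MeasurePreserving (hiterN T n) μ μ := by
  induction n with
  | zero => exact MeasurePreserving.id μ
  | succ n ih => exact hμ.comp ih

theorem integral_hiter {T : X ≃ₜ X} {μ : Measure X} (hμ : MeasurePreserving T μ μ) (n : ℤ) :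
    MeasurePreserving (hiter T n) μ μ := by
  cases n with
  | ofNat n => exact integral_hiterN hμ n
  | negSucc n =>
    exact MeasurePreserving.symm (hiterN T (n + 1)).toMeasurableEquiv (integral_hiterN hμ (n + 1))

theorem integral_comp_homeo {S : X ≃ₜ X} {μ : Measure X} (hμ : MeasurePreserving S μ μ)
    (f : C(X, ℝ)) : ∫ x, f (S x) ∂μ = ∫ x, f x ∂μ :=
  hμ.integral_comp S.measurableEmbedding (fun x => f x)

theorem lower_bound (T : X ≃ₜ X) (F : Finset C(X, ℝ))
    (hF : closure (Submodule.span ℝ (iterSet T (F : Set C(X, ℝ)) ∪ cobSet T) : Set C(X, ℝ))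
      = Set.univ) :
    {μ : Measure X | IsProbabilityMeasure μ ∧ Ergodic (⇑T) μ}.encard ≤ F.card := by
  by_contra hlt
  push Not at hlt
  obtain ⟨t, htS, htc⟩ := Set.exists_subset_encard_eq (Order.add_one_le_of_lt hlt)
  have htf : t.Finite := by
    apply Set.finite_of_encard_eq_coe (k := F.card + 1)
    rw [htc]; simp
  lift t to Finset (Measure X) using htf
  rw [Set.encard_coe_eq_coe_finsetCard] at htc
  have htc' : t.card = F.card + 1 := by exact_mod_cast htc
  have ht : ∀ μ ∈ t, IsProbabilityMeasure μ ∧ Ergodic T μ := fun μ hμ => htS hμ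
  have hli : LinearIndependent ℝ (fun (μ : t) (f : F) => ∫ x, f.1 x ∂μ.1) := by
    rw [Fintype.linearIndependent_iff]
    intro c hc
    classical
    have hPi : ∀ μ : t, IsProbabilityMeasure μ.1 := fun μ => (ht μ.1 μ.2).1
    let L : C(X, ℝ) →L[ℝ] ℝ := ∑ μ : t, c μ • intCLM μ.1
    have hL : ∀ g, L g = ∑ μ : t, c μ * ∫ x, g x ∂μ.1 := by
      intro g
      simp [L, intCLM_apply]
    have hLF : ∀ f ∈ F, L f = 0 := by
      intro f hf
      rw [hL]
      have := congrFun hc ⟨f, hf⟩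
      simpa using this
    have hLinv : ∀ (S : X ≃ₜ X), (∀ μ ∈ t, MeasurePreserving S μ μ) → ∀ f : C(X, ℝ),
        L (f.comp (S : C(X, X))) = L f := by
      intro S hS f
      rw [hL, hL]
      refine Finset.sum_congr rfl fun μ _ => ?_
      congr 1
      exact integral_comp_homeo (hS μ.1 μ.2) f
    have hspan : Submodule.span ℝ (iterSet T (F : Set C(X, ℝ)) ∪ cobSet T) ≤
        LinearMap.ker (L : C(X, ℝ) →ₗ[ℝ] ℝ) := by
      rw [Submodule.span_le]
      rintro g (⟨f, hf, n, rfl⟩ | ⟨φ, rfl⟩)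
      · show L _ = 0
        rw [hLinv _ fun μ hμ => integral_hiter (ht μ hμ).2.toMeasurePreserving n]
        exact hLF f hf
      · show L _ = 0
        rw [map_sub, hLinv _ fun μ hμ => (ht μ hμ).2.toMeasurePreserving, sub_self]
    have hL0 : ∀ g, L g = 0 := by
      intro g
      have hg : g ∈ closure (Submodule.span ℝ (iterSet T (F : Set C(X, ℝ)) ∪ cobSet T) :
        Set C(X, ℝ)) := by rw [hF]; trivial
      have hcl : IsClosed {g | L g = 0} := isClosed_eq L.continuous continuous_const
      exact closure_minimal (fun x hx => hspan hx) hcl hg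
    have key := zero_of_relation t ht (fun μ => if h : μ ∈ t then c ⟨μ, h⟩ else 0) (by
      intro g
      rw [← hL0 g, hL, ← Finset.sum_attach]
      refine Finset.sum_congr rfl fun μ _ => ?_
      simp)
    intro μ
    have := key μ.1 μ.2
    simpa using this
  have := hli.fintype_card_le_finrank
  simp [htc'] at this

/-- invariant states -/
def stateSet (X : Type*) [MetricSpace X] [CompactSpace X] : Set (WeakDual ℝ C(X, ℝ)) :=
  {φ | (∀ f : C(X, ℝ), 0 ≤ f → 0 ≤ φ f) ∧ φ 1 = 1}

def invStateSet (T : X ≃ₜ X) : Set (WeakDual ℝ C(X, ℝ)) :=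
  stateSet X ∩ {φ | ∀ f : C(X, ℝ), φ (f.comp (T : C(X, X))) = φ f}

theorem isClosed_stateSet : IsClosed (stateSet X) := by
  have : stateSet X = (⋂ f : C(X, ℝ), ⋂ _ : 0 ≤ f, {φ : WeakDual ℝ C(X, ℝ) | 0 ≤ φ f}) ∩
      {φ : WeakDual ℝ C(X, ℝ) | φ 1 = 1} := by
    ext φ; simp [stateSet]
  rw [this]
  refine IsClosed.inter (isClosed_iInter fun f => isClosed_iInter fun _ => ?_) ?_
  · exact isClosed_le continuous_const (WeakDual.eval_continuous f)
  · exact isClosed_eq (WeakDual.eval_continuous _) continuous_const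

theorem isCompact_stateSet : IsCompact (stateSet X) := by
  refine (WeakDual.isCompact_closedBall (𝕜 := ℝ) (E := C(X, ℝ)) 0 1).of_isClosed_subset
    isClosed_stateSet ?_
  rintro φ ⟨hpos, h1⟩
  rw [Set.mem_preimage, mem_closedBall_zero_iff]
  refine ContinuousLinearMap.opNorm_le_bound _ zero_le_one fun f => ?_
  show ‖φ f‖ ≤ _
  have e1 : 0 ≤ φ (‖f‖ • (1 : C(X, ℝ)) - f) := hpos _ fun x => by
    have := f.norm_coe_le_norm x
    simp only [Real.norm_eq_abs, abs_le] at this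
    simpa using this.2
  have e2 : 0 ≤ φ (‖f‖ • (1 : C(X, ℝ)) + f) := hpos _ fun x => by
    have := f.norm_coe_le_norm x
    simp only [Real.norm_eq_abs, abs_le] at this
    show 0 ≤ ‖f‖ * 1 + f x
    linarith [this.1]
  rw [map_sub, map_smul, h1] at e1
  rw [map_add, map_smul, h1] at e2
  simp only [smul_eq_mul, mul_one] at e1 e2
  rw [Real.norm_eq_abs, abs_le]
  constructor <;> linarith

theorem isCompact_invStateSet (T : X ≃ₜ X) : IsCompact (invStateSet T) := by
  refine isCompact_stateSet.inter_right ?_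
  rw [Set.ofPred_forall]
  exact isClosed_iInter fun f =>
    isClosed_eq (WeakDual.eval_continuous _) (WeakDual.eval_continuous _)

theorem exists_measure_of_state {φ : WeakDual ℝ C(X, ℝ)} (hφ : φ ∈ stateSet X) :
    ∃ μ : Measure X, IsProbabilityMeasure μ ∧ ∀ f : C(X, ℝ), ∫ x, f x ∂μ = φ f := by
  let Λ : CompactlySupportedContinuousMap X ℝ →ₚ[ℝ] ℝ := PositiveLinearMap.mk₀
    { toFun := fun g => φ g.toContinuousMap
      map_add' := fun g g' => map_add φ g.toContinuousMap g'.toContinuousMap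
      map_smul' := fun c g => map_smul φ c g.toContinuousMap }
    (fun g hg => hφ.1 _ hg)
  have key : ∀ f : C(X, ℝ), ∫ x, f x ∂(RealRMK.rieszMeasure Λ) = φ f := fun f =>
    RealRMK.integral_rieszMeasure Λ ⟨f, HasCompactSupport.of_compactSpace _⟩
  refine ⟨RealRMK.rieszMeasure Λ, ?_, key⟩
  have h := key 1
  rw [hφ.2] at h
  simp only [ContinuousMap.one_apply, integral_const, smul_eq_mul, mul_one] at h
  constructor
  rw [measureReal_def, ENNReal.toReal_eq_one_iff] at h
  exact h

theorem intCLM_mem {T : X ≃ₜ X} {μ : Measure X} [IsProbabilityMeasure μ]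
    (hμ : MeasurePreserving T μ μ) :
    (StrongDual.toWeakDual (intCLM μ) : WeakDual ℝ C(X, ℝ)) ∈ invStateSet T := by
  refine ⟨⟨fun f hf => integral_nonneg hf, ?_⟩, fun f => integral_comp_homeo hμ f⟩
  show ∫ x, (1 : C(X, ℝ)) x ∂μ = 1
  simp

theorem ergodic_of_extreme {T : X ≃ₜ X} {φ : WeakDual ℝ C(X, ℝ)}
    (hφ : φ ∈ (invStateSet T).extremePoints ℝ) :
    ∃ μ : Measure X, (IsProbabilityMeasure μ ∧ Ergodic T μ) ∧ ∀ f : C(X, ℝ), ∫ x, f x ∂μ = φ f := by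
  obtain ⟨μ, hP, hμ⟩ := exists_measure_of_state hφ.1.1
  refine ⟨μ, ⟨hP, ?_⟩, hμ⟩
  have hmp : MeasurePreserving T μ μ := by
    refine ⟨T.continuous.measurable, ?_⟩
    have := Measure.isProbabilityMeasure_map (μ := μ) T.continuous.measurable.aemeasurable
    apply measure_ext_cont
    intro f
    rw [integral_map T.continuous.measurable.aemeasurable f.continuous.aestronglyMeasurable,
      hμ, ← hφ.1.2 f]
    exact hμ (f.comp (T : C(X, X)))
  apply Ergodic.of_mem_extremePoints
  rw [mem_extremePoints_iff_left]
  refine ⟨⟨hmp, hP⟩, ?_⟩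
  rintro ν₁ ⟨hm1, hp1⟩ ν₂ ⟨hm2, hp2⟩ ⟨a, b, ha, hb, hab, hs⟩
  have ha' : a ≠ ⊤ := fun h => by simp [h] at hab
  have hb' : b ≠ ⊤ := fun h => by simp [h] at hab
  have h1 := hφ.2 (intCLM_mem hm1) (intCLM_mem hm2) ⟨a.toReal, b.toReal,
    ENNReal.toReal_pos ha.ne' ha', ENNReal.toReal_pos hb.ne' hb', by
      rw [← ENNReal.toReal_add ha' hb', hab]; simp, by
      refine DFunLike.ext _ _ fun f => ?_
      show a.toReal * ∫ x, f x ∂ν₁ + b.toReal * ∫ x, f x ∂ν₂ = φ f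
      rw [← hμ, ← hs, integral_add_measure, integral_smul_measure, integral_smul_measure]
      · rfl
      · exact (cont_integrable _ f).smul_measure ha'
      · exact (cont_integrable _ f).smul_measure hb'⟩
  apply measure_ext_cont
  intro f
  rw [hμ, ← h1]
  rfl

theorem exists_ergodic_ne_zero {T : X ≃ₜ X} {φ : WeakDual ℝ C(X, ℝ)} (hφ : φ ∈ invStateSet T)
    (g : C(X, ℝ)) (hg : 0 < φ g) :
    ∃ μ : Measure X, (IsProbabilityMeasure μ ∧ Ergodic T μ) ∧ 0 < ∫ x, g x ∂μ := by
  have hcont : Continuous fun ψ : WeakDual ℝ C(X, ℝ) => ψ g := WeakDual.eval_continuous g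
  obtain ⟨ψ, hψ, hmax⟩ := (isCompact_invStateSet T).exists_isMaxOn ⟨φ, hφ⟩ hcont.continuousOn
  have hmax' : ∀ χ ∈ invStateSet T, χ g ≤ ψ g := fun χ hχ => hmax hχ
  have hM : IsCompact (invStateSet T ∩ {χ : WeakDual ℝ C(X, ℝ) | χ g = ψ g}) :=
    (isCompact_invStateSet T).inter_right (isClosed_eq hcont continuous_const)
  have hLC : LocallyConvexSpace ℝ (WeakDual ℝ C(X, ℝ)) :=
    (LinearMap.weakBilin_withSeminorms (topDualPairing ℝ C(X, ℝ))).toLocallyConvexSpace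
  obtain ⟨χ, hχ⟩ := hM.extremePoints_nonempty ⟨ψ, hψ, rfl⟩
  have hχ' : χ ∈ (invStateSet T).extremePoints ℝ := by
    rw [mem_extremePoints_iff_left]
    refine ⟨hχ.1.1, ?_⟩
    rintro x hx y hy ⟨a, b, ha, hb, hab, hs⟩
    have e : a * x g + b * y g = ψ g := by
      rw [← hχ.1.2, ← hs]; rfl
    have hxg := hmax' x hx
    have hyg := hmax' y hy
    have e2 : a * (ψ g - x g) + b * (ψ g - y g) = 0 := by
      have : a * ψ g + b * ψ g = ψ g := by rw [← add_mul, hab, one_mul]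
      linarith
    have n1 : 0 ≤ a * (ψ g - x g) := mul_nonneg ha.le (by linarith)
    have n2 : 0 ≤ b * (ψ g - y g) := mul_nonneg hb.le (by linarith)
    have z1 : a * (ψ g - x g) = 0 := by linarith
    have z2 : b * (ψ g - y g) = 0 := by linarith
    have z1' : x g = ψ g := by
      rcases mul_eq_zero.1 z1 with h | h <;> linarith
    have z2' : y g = ψ g := by
      rcases mul_eq_zero.1 z2 with h | h <;> linarith
    exact hχ.2 ⟨hx, z1'⟩ ⟨hy, z2'⟩ ⟨a, b, ha, hb, hab, hs⟩
  obtain ⟨μ, hμ, hi⟩ := ergodic_of_extreme hχ'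
  refine ⟨μ, hμ, ?_⟩
  rw [hi, hχ.1.2]
  exact hg.trans_le (hmax' φ hφ)

/-- ergodic sums -/
noncomputable def bsum (T : X ≃ₜ X) (g : C(X, ℝ)) (N : ℕ) : C(X, ℝ) :=
  ∑ n ∈ Finset.range N, g.comp (hiterN T n : C(X, X))

theorem hiterN_succ_apply (T : X ≃ₜ X) (n : ℕ) (x : X) : hiterN T (n + 1) x = T (hiterN T n x) :=
  rfl

theorem hiterN_succ_apply' (T : X ≃ₜ X) (n : ℕ) (x : X) :
    hiterN T (n + 1) x = hiterN T n (T x) := by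
  induction n with
  | zero => rfl
  | succ n ih => rw [hiterN_succ_apply, ih, ← hiterN_succ_apply]

theorem iter_sub_mem (T : X ≃ₜ X) (g : C(X, ℝ)) (n : ℕ) :
    g.comp (hiterN T n : C(X, X)) - g ∈ Submodule.span ℝ (cobSet T) := by
  induction n with
  | zero =>
    have : g.comp (hiterN T 0 : C(X, X)) - g = 0 := by
      ext x; simp [hiterN]
    rw [this]; exact Submodule.zero_mem _
  | succ n ih =>
    have : g.comp (hiterN T (n + 1) : C(X, X)) - g =
        ((g.comp (hiterN T n : C(X, X))).comp (T : C(X, X)) - g.comp (hiterN T n : C(X, X))) +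
        (g.comp (hiterN T n : C(X, X)) - g) := by
      ext x
      simp [hiterN_succ_apply']
    rw [this]
    exact Submodule.add_mem _ (Submodule.subset_span ⟨_, rfl⟩) ih

theorem avg_sub_mem (T : X ≃ₜ X) (g : C(X, ℝ)) (N : ℕ) :
    g - ((N + 1 : ℕ) : ℝ)⁻¹ • bsum T g (N + 1) ∈ Submodule.span ℝ (cobSet T) := by
  have : g - ((N + 1 : ℕ) : ℝ)⁻¹ • bsum T g (N + 1) =
      (-((N + 1 : ℕ) : ℝ)⁻¹) •
        ∑ n ∈ Finset.range (N + 1), (g.comp (hiterN T n : C(X, X)) - g) := by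
    rw [Finset.sum_sub_distrib, Finset.sum_const, Finset.card_range, smul_sub, bsum,
      ← Nat.cast_smul_eq_nsmul ℝ, smul_smul, neg_mul, inv_mul_cancel₀ (by positivity)]
    module
  rw [this]
  exact Submodule.smul_mem _ _ (Submodule.sum_mem _ fun n _ => iter_sub_mem T g n)

/-- empirical functionals -/
noncomputable def emp (T : X ≃ₜ X) (N : ℕ) (x : X) : WeakDual ℝ C(X, ℝ) :=
  StrongDual.toWeakDual (((N + 1 : ℕ) : ℝ)⁻¹ •
    ∑ n ∈ Finset.range (N + 1), ContinuousMap.evalCLM ℝ (hiterN T n x))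

theorem emp_apply (T : X ≃ₜ X) (N : ℕ) (x : X) (f : C(X, ℝ)) :
    emp T N x f = ((N + 1 : ℕ) : ℝ)⁻¹ * ∑ n ∈ Finset.range (N + 1), f (hiterN T n x) := by
  show (((N + 1 : ℕ) : ℝ)⁻¹ •
    ∑ n ∈ Finset.range (N + 1), ContinuousMap.evalCLM ℝ (hiterN T n x) : C(X, ℝ) →L[ℝ] ℝ) f = _
  simp [ContinuousMap.evalCLM]

theorem emp_mem (T : X ≃ₜ X) (N : ℕ) (x : X) : emp T N x ∈ stateSet X := by
  refine ⟨fun f hf => ?_, ?_⟩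
  · rw [emp_apply]
    exact mul_nonneg (by positivity) (Finset.sum_nonneg fun n _ => hf _)
  · rw [emp_apply]
    simp only [ContinuousMap.one_apply, Finset.sum_const, Finset.card_range, nsmul_eq_mul, mul_one]
    exact inv_mul_cancel₀ (by positivity)

theorem emp_inv (T : X ≃ₜ X) (N : ℕ) (x : X) (f : C(X, ℝ)) :
    |emp T N x (f.comp (T : C(X, X))) - emp T N x f| ≤ (2 * ‖f‖) * (1 / ((N : ℝ) + 1)) := by
  rw [emp_apply, emp_apply, ← mul_sub, ← Finset.sum_sub_distrib]
  have : ∑ n ∈ Finset.range (N + 1),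
      ((f.comp (T : C(X, X))) (hiterN T n x) - f (hiterN T n x)) =
      f (hiterN T (N + 1) x) - f (hiterN T 0 x) :=
    Finset.sum_range_sub (fun n => f (hiterN T n x)) (N + 1)
  rw [this, abs_mul, abs_of_nonneg (by positivity : (0 : ℝ) ≤ ((N + 1 : ℕ) : ℝ)⁻¹), mul_comm,
    one_div]
  push_cast
  gcongr
  have h1 := f.norm_coe_le_norm (hiterN T (N + 1) x)
  have h2 := f.norm_coe_le_norm (hiterN T 0 x)
  calc _ ≤ ‖f (hiterN T (N + 1) x)‖ + ‖f (hiterN T 0 x)‖ := norm_sub_le _ _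
    _ ≤ _ := by linarith

theorem exists_inv_state {T : X ≃ₜ X} {g : C(X, ℝ)}
    (hg : g ∉ closure (Submodule.span ℝ (cobSet T) : Set C(X, ℝ))) :
    ∃ φ ∈ invStateSet T, φ g ≠ 0 := by
  rw [Metric.mem_closure_iff] at hg
  push Not at hg
  obtain ⟨ε, hε, hd⟩ := hg
  have hx : ∀ N : ℕ, ∃ x : X, ε ≤ |emp T N x g| := by
    intro N
    by_contra hcon
    push Not at hcon
    have h1 := hd _ (avg_sub_mem T g N)
    rw [dist_eq_norm, sub_sub_cancel] at h1
    refine absurd h1 (not_le.2 ?_)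
    rw [ContinuousMap.norm_lt_iff _ hε]
    intro x
    have h2 := hcon x
    rw [emp_apply] at h2
    simpa [bsum, ContinuousMap.sum_apply] using h2
  choose x hx using hx
  let U : Ultrafilter ℕ := hyperfilter ℕ
  have hU : (U : Filter ℕ) ≤ atTop := Nat.hyperfilter_le_atTop
  obtain ⟨φ, hφ, hlim⟩ := (isCompact_stateSet (X := X)).ultrafilter_le_nhds
    (U.map fun N => emp T N (x N))
    (by
      rw [le_principal_iff]
      show ∀ᶠ N in (U : Filter ℕ), emp T N (x N) ∈ stateSet X
      exact Filter.Eventually.of_forall fun N => emp_mem T N (x N))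
  have hlim' : Tendsto (fun N => emp T N (x N)) U (𝓝 φ) := hlim
  have hev : ∀ f : C(X, ℝ), Tendsto (fun N => emp T N (x N) f) U (𝓝 (φ f)) := fun f =>
    ((WeakDual.eval_continuous f).tendsto φ).comp hlim'
  refine ⟨φ, ⟨hφ, fun f => ?_⟩, ?_⟩
  · have h1 := (hev (f.comp (T : C(X, X)))).sub (hev f)
    have h2 : Tendsto (fun N : ℕ => (2 * ‖f‖) * (1 / ((N : ℝ) + 1))) U (𝓝 0) := by
      have := (tendsto_one_div_add_atTop_nhds_zero_nat (𝕜 := ℝ)).const_mul (2 * ‖f‖)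
      rw [mul_zero] at this
      exact this.mono_left hU
    have h3 := squeeze_zero_norm (f := fun N => emp T N (x N) (f.comp (T : C(X, X))) - emp T N (x N) f)
      (fun N => emp_inv T N (x N) f) h2
    exact sub_eq_zero.1 (tendsto_nhds_unique h1 h3)
  · have h1 : ε ≤ |φ g| := ge_of_tendsto (hev g).abs (Filter.Eventually.of_forall hx)
    intro h0
    rw [h0, abs_zero] at h1
    linarith

theorem mem_closure_cob {T : X ≃ₜ X} {g : C(X, ℝ)}
    (hg : ∀ μ : Measure X, (IsProbabilityMeasure μ ∧ Ergodic T μ) → ∫ x, g x ∂μ = 0) :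
    g ∈ closure (Submodule.span ℝ (cobSet T) : Set C(X, ℝ)) := by
  by_contra hcon
  obtain ⟨φ, hφ, hne⟩ := exists_inv_state hcon
  rcases lt_or_gt_of_ne hne with h | h
  · obtain ⟨μ, hμ, hp⟩ := exists_ergodic_ne_zero hφ (-g) (by rw [map_neg]; linarith)
    simp only [ContinuousMap.neg_apply, integral_neg, hg μ hμ] at hp
    simp at hp
  · obtain ⟨μ, hμ, hp⟩ := exists_ergodic_ne_zero hφ g h
    rw [hg μ hμ] at hp
    exact lt_irrefl _ hp

theorem upper_bound (T : X ≃ₜ X)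
    (hfin : {μ : Measure X | IsProbabilityMeasure μ ∧ Ergodic (⇑T) μ}.Finite) :
    ∃ F : Finset C(X, ℝ),
      (F.card : ℕ∞) ≤ {μ : Measure X | IsProbabilityMeasure μ ∧ Ergodic (⇑T) μ}.encard ∧
      closure (Submodule.span ℝ (iterSet T (F : Set C(X, ℝ)) ∪ cobSet T) : Set C(X, ℝ))
        = Set.univ := by
  classical
  set S := {μ : Measure X | IsProbabilityMeasure μ ∧ Ergodic (⇑T) μ} with hS
  have : Fintype S := hfin.fintype
  have hPi : ∀ μ : S, IsProbabilityMeasure μ.1 := fun μ => μ.2.1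
  let Φ : C(X, ℝ) →ₗ[ℝ] (S → ℝ) :=
    LinearMap.pi fun μ => (intCLM μ.1 : C(X, ℝ) →ₗ[ℝ] ℝ)
  let b := Module.finBasis ℝ (LinearMap.range Φ)
  choose f hf using fun i => (b i).2
  have hcard : Module.finrank ℝ (LinearMap.range Φ) ≤ Fintype.card S := by
    simpa using Submodule.finrank_le (LinearMap.range Φ)
  refine ⟨Finset.univ.image f, ?_, ?_⟩
  · rw [Set.encard_eq_coe_toFinset_card, Set.toFinset_card]
    have : (Finset.univ.image f).card ≤ _ := Finset.card_image_le
    rw [Finset.card_univ, Fintype.card_fin] at this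
    exact_mod_cast this.trans hcard
  · rw [Set.eq_univ_iff_forall]
    intro g
    set V := Submodule.span ℝ (iterSet T ((Finset.univ.image f : Finset C(X, ℝ)) :
      Set C(X, ℝ)) ∪ cobSet T) with hV
    show g ∈ V.topologicalClosure
    let r := b.repr ⟨Φ g, LinearMap.mem_range_self Φ g⟩
    have hr : Φ g = ∑ i, r i • Φ (f i) := by
      have := congrArg Subtype.val (b.sum_repr ⟨Φ g, LinearMap.mem_range_self Φ g⟩)
      rw [Submodule.coe_sum] at this
      simp only [Submodule.coe_smul] at this
      rw [← this]
      exact Finset.sum_congr rfl fun i _ => by rw [hf]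
    have h1 : g - ∑ i, r i • f i ∈ V.topologicalClosure := by
      have : g - ∑ i, r i • f i ∈ closure (Submodule.span ℝ (cobSet T) : Set C(X, ℝ)) := by
        apply mem_closure_cob
        intro μ hμ
        have h0 : Φ (g - ∑ i, r i • f i) = 0 := by
          rw [map_sub, map_sum, hr, sub_eq_zero]
          exact Finset.sum_congr rfl fun i _ => by rw [map_smul]
        exact congrFun h0 ⟨μ, hμ⟩
      exact closure_mono (Submodule.span_mono Set.subset_union_right) this
    have h2 : ∑ i, r i • f i ∈ V.topologicalClosure := by
      refine Submodule.sum_mem _ fun i _ => Submodule.smul_mem _ _ ?_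
      refine Submodule.le_topologicalClosure _ (Submodule.subset_span (Or.inl ?_))
      refine ⟨f i, by simp, 0, ?_⟩
      ext x; rfl
    have := Submodule.add_mem _ h1 h2
    rwa [sub_add_cancel] at this

end Helpers

/-- For a topological dynamical system `(X, T)`, the minimal cardinality of a finite
`F ⊆ C(X)` whose iterates together with the coboundaries span a dense subspace of `C(X)`
equals the number of ergodic `T`-invariant Borel probability measures on `X`
(as elements of `ℕ ∪ {∞}`). -/
theorem multModCoboundaries_eq_encard_ergodic
    {X : Type*} [MetricSpace X] [CompactSpace X] [MeasurableSpace X] [BorelSpace X]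
    (T : X ≃ₜ X) :
    multModCoboundaries T
      = {μ : Measure X | IsProbabilityMeasure μ ∧ Ergodic (⇑T) μ}.encard := by
  apply le_antisymm
  · by_cases hfin : {μ : Measure X | IsProbabilityMeasure μ ∧ Ergodic (⇑T) μ}.Finite
    · obtain ⟨F, hF, hcl⟩ := upper_bound T hfin
      refine le_trans (sInf_le ?_) hF
      exact ⟨F, rfl, hcl⟩
    · rw [Set.Infinite.encard_eq hfin]
      exact le_top
  · refine le_sInf ?_
    rintro c ⟨F, rfl, hcl⟩
    exact lower_bound T F hcl
end

section
/- Let (X,T) be a minimal Cantor system of topological rank at most d, i.e. admitting a primitive sequence of nested Kakutani–Rohlin partitions (T_n)_{n≥0} with d_n ≤ d for all n. Then there exists a set F ⊆ C(X) with at most d elements such that the linear span of {f ∘ Tⁿ : f ∈ F, n ∈ ℤ} is dense in C(X); that is, Mult(T) ≤ d. -/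
/-- A Kakutani–Rohlin partition of `X` for the homeomorphism `T`: clopen bases `B k`
with heights `h k`, whose towers `T^{-j} B(k)`, `0 ≤ j < h k`, partition `X`, and with
`⋃ₖ T^{-h(k)} B(k) = ⋃ₖ B(k)`. -/
structure KRPartition (X : Type*) [TopologicalSpace X] (T : X ≃ₜ X) where
  /-- number of towers -/
  d : ℕ
  d_pos : 0 < d
  /-- heights of the towers -/
  h : Fin d → ℕ
  h_pos : ∀ k, 0 < h k
  /-- bases of the towers -/
  B : Fin d → Set X
  isClopen : ∀ k, IsClopen (B k)
  cover : (⋃ k, ⋃ j ∈ Finset.range (h k), (⇑T)^[j] ⁻¹' (B k)) = Set.univ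
  disjoint : ∀ k k' : Fin d, ∀ j j' : ℕ, j < h k → j' < h k' → (k, j) ≠ (k', j') →
    Disjoint ((⇑T)^[j] ⁻¹' (B k)) ((⇑T)^[j'] ⁻¹' (B k'))
  base_ret : (⋃ k, (⇑T)^[h k] ⁻¹' (B k)) = ⋃ k, B k

/-- The base `B(𝒯) = ⋃ₖ B(k)` of a Kakutani–Rohlin partition. -/
def KRPartition.base {X : Type*} [TopologicalSpace X] {T : X ≃ₜ X}
    (P : KRPartition X T) : Set X :=
  ⋃ k, P.B k

section MultRank

open Polynomial


/-- The Koopman operator `f ↦ f ∘ T` (for any homeomorphism). -/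
noncomputable def koop (𝕜 : Type*) [RCLike 𝕜] {X : Type*} [TopologicalSpace X] [CompactSpace X]
    (T : X ≃ₜ X) : C(X, 𝕜) →L[𝕜] C(X, 𝕜) :=
  LinearMap.mkContinuous
    { toFun := fun f => f.comp (T : C(X, X))
      map_add' := fun _ _ => rfl
      map_smul' := fun _ _ => rfl } 1 (by
      intro f
      rw [one_mul]
      refine (ContinuousMap.norm_le _ (norm_nonneg _)).2 fun x => ?_
      exact f.norm_coe_le_norm (T x))

theorem koop_apply (𝕜 : Type*) [RCLike 𝕜] {X : Type*} [TopologicalSpace X] [CompactSpace X]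
    (T : X ≃ₜ X) (f : C(X, 𝕜)) (x : X) : koop 𝕜 T f x = f (T x) := rfl

theorem koop_norm_le (𝕜 : Type*) [RCLike 𝕜] {X : Type*} [TopologicalSpace X] [CompactSpace X]
    (T : X ≃ₜ X) : ‖koop 𝕜 T‖ ≤ 1 :=
  LinearMap.mkContinuous_norm_le _ zero_le_one _

theorem koop_pow_apply (𝕜 : Type*) [RCLike 𝕜] {X : Type*} [TopologicalSpace X] [CompactSpace X]
    (T : X ≃ₜ X) (n : ℕ) (f : C(X, 𝕜)) (x : X) : (koop 𝕜 T ^ n) f x = f (T^[n] x) := by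
  induction n generalizing x with
  | zero => rfl
  | succ n ih =>
    rw [pow_succ', mul_apply_eq_comp, koop_apply, ih, Function.iterate_succ_apply]

theorem aeval_koop_monomial (𝕜 : Type*) [RCLike 𝕜] {X : Type*} [TopologicalSpace X]
    [CompactSpace X] (T : X ≃ₜ X) (n : ℕ) (a : 𝕜) (f : C(X, 𝕜)) :
    aeval (koop 𝕜 T) (monomial n a) f = a • (koop 𝕜 T ^ n) f := by
  rw [aeval_monomial, ← Algebra.smul_def]
  rfl

theorem isUnit_aeval_of_circle {A : Type*} [NormedRing A] [NormedAlgebra ℂ A] [CompleteSpace A]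
    (h1 : ‖(1 : A)‖ ≤ 1) (u : Aˣ) (hu : ‖(u : A)‖ ≤ 1) (hv : ‖((u⁻¹ : Aˣ) : A)‖ ≤ 1)
    (q : ℂ[X]) (hq : ∀ z : ℂ, ‖z‖ = 1 → q.eval z ≠ 0) : IsUnit (aeval (u : A) q) := by
  by_contra hn
  have hq0 : q ≠ 0 := by
    rintro rfl
    exact hq 1 (by simp) (by simp)
  have hsp := (IsAlgClosed.splits q).eq_prod_roots
  rw [hsp, map_mul, aeval_C] at hn
  have hlead : IsUnit (algebraMap ℂ A q.leadingCoeff) :=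
    (IsUnit.mk0 _ (leadingCoeff_ne_zero.2 hq0)).map _
  have hn' : ¬ IsUnit (aeval (u : A) (Multiset.map (fun x : ℂ => X - C x) q.roots).prod) :=
    fun h => hn (hlead.mul h)
  obtain ⟨k, hk, hk0⟩ := spectrum.exists_mem_of_not_isUnit_aeval_prod hn'
  have hkne : k ≠ 0 := by
    rintro rfl
    exact spectrum.zero_notMem ℂ u.isUnit hk
  have hk1 : ‖k‖ ≤ 1 := (spectrum.norm_le_norm_mul_of_mem hk).trans
    (mul_le_one₀ hu (norm_nonneg _) h1)
  have hk2 : ‖k⁻¹‖ ≤ 1 := by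
    have := (spectrum.inv_mem_iff (r := Units.mk0 k hkne) (a := u)).1 hk
    have := (spectrum.norm_le_norm_mul_of_mem this).trans (mul_le_one₀ hv (norm_nonneg _) h1)
    simpa using this
  refine hq k (le_antisymm hk1 ?_) hk0
  rw [norm_inv] at hk2
  exact (inv_le_one₀ (norm_pos_iff.2 hkne)).1 hk2

/-- Real submodule `M` to complex submodule. -/
noncomputable def cplx {X : Type*} [TopologicalSpace X] [CompactSpace X]
    (M : Submodule ℝ C(X, ℝ)) : Submodule ℂ C(X, ℂ) where
  carrier := {f | Complex.reCLM.compLeftContinuous ℝ X f ∈ M ∧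
    Complex.imCLM.compLeftContinuous ℝ X f ∈ M}
  add_mem' := by
    rintro a b ⟨h1, h2⟩ ⟨h3, h4⟩
    simp only [Set.mem_ofPred_eq, map_add]
    exact ⟨M.add_mem h1 h3, M.add_mem h2 h4⟩
  zero_mem' := by simp
  smul_mem' := by
    rintro c f ⟨h1, h2⟩
    constructor
    · convert M.sub_mem (M.smul_mem c.re h1) (M.smul_mem c.im h2) using 1
      ext x
      simp [Complex.mul_re]
    · convert M.add_mem (M.smul_mem c.re h2) (M.smul_mem c.im h1) using 1
      ext x
      simp [Complex.mul_im]

/-- operators preserving a submodule -/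
def presAlg {E : Type*} [NormedAddCommGroup E] [NormedSpace ℂ E] (W : Submodule ℂ E) :
    Subalgebra ℂ (E →L[ℂ] E) where
  carrier := {a | ∀ w ∈ W, a w ∈ W}
  mul_mem' := fun ha hb w hw => ha _ (hb w hw)
  add_mem' := fun ha hb w hw => W.add_mem (ha w hw) (hb w hw)
  algebraMap_mem' := fun c w hw => by
    simpa [Algebra.algebraMap_eq_smul_one] using W.smul_mem c hw

theorem isClosed_presAlg {E : Type*} [NormedAddCommGroup E] [NormedSpace ℂ E]
    (W : Submodule ℂ E) (hW : IsClosed (W : Set E)) :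
    IsClosed (presAlg W : Set (E →L[ℂ] E)) := by
  have : (presAlg W : Set (E →L[ℂ] E)) = ⋂ w ∈ W, {a | a w ∈ (W : Set E)} := by
    ext a
    simp only [Set.mem_iInter]
    rfl
  rw [this]
  refine isClosed_biInter fun w _ => hW.preimage ?_
  fun_prop

theorem mem_of_aeval_mem {X : Type*} [TopologicalSpace X] [CompactSpace X] (T : X ≃ₜ X)
    (M : Submodule ℝ C(X, ℝ)) (hM : IsClosed (M : Set C(X, ℝ)))
    (h1 : ∀ f ∈ M, koop ℝ T f ∈ M) (h2 : ∀ f ∈ M, koop ℝ T.symm f ∈ M)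
    (q : ℝ[X]) (hq : ∀ z : ℂ, ‖z‖ = 1 → aeval z q ≠ 0) (f : C(X, ℝ))
    (hf : aeval (koop ℝ T) q f ∈ M) : f ∈ M := by
  set W := cplx M with hWdef
  have hW : IsClosed (W : Set C(X, ℂ)) :=
    (hM.preimage (Complex.reCLM.compLeftContinuous ℝ X).continuous).inter
      (hM.preimage (Complex.imCLM.compLeftContinuous ℝ X).continuous)
  let S := presAlg W
  have hS := isClosed_presAlg W hW
  have : CompleteSpace S := hS.completeSpace_coe
  let u : Sˣ :=
    { val := ⟨koop ℂ T, fun w hw => ⟨h1 _ hw.1, h1 _ hw.2⟩⟩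
      inv := ⟨koop ℂ T.symm, fun w hw => ⟨h2 _ hw.1, h2 _ hw.2⟩⟩
      val_inv := by
        apply Subtype.ext
        ext w x
        simp [koop_apply]
      inv_val := by
        apply Subtype.ext
        ext w x
        simp [koop_apply] }
  have hun : IsUnit (aeval (u : S) (q.map (algebraMap ℝ ℂ))) := by
    refine isUnit_aeval_of_circle ?_ u (koop_norm_le ℂ T) (koop_norm_le ℂ T.symm) _ ?_
    · exact ContinuousLinearMap.norm_id_le
    · intro z hz
      rw [eval_map_algebraMap]
      exact hq z hz
  obtain ⟨b, hb⟩ := hun.exists_left_inv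
  let J : C(X, ℝ) →L[ℝ] C(X, ℂ) := Complex.ofRealCLM.compLeftContinuous ℝ X
  have hJ : ∀ p : ℝ[X], ∀ g : C(X, ℝ),
      aeval (koop ℂ T) (p.map (algebraMap ℝ ℂ)) (J g) = J (aeval (koop ℝ T) p g) := by
    intro p g
    induction p using Polynomial.induction_on' with
    | add p q hp hq =>
      rw [Polynomial.map_add, map_add, map_add, add_apply, hp, hq,
        add_apply, map_add]
    | monomial n a =>
      rw [map_monomial, aeval_koop_monomial, aeval_koop_monomial]
      ext x
      rw [map_smul, ContinuousMap.smul_apply, ContinuousMap.smul_apply, koop_pow_apply]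
      change _ = a • ((((koop ℝ T) ^ n) g x : ℝ) : ℂ)
      rw [koop_pow_apply]
      simp [J]
  have hJW : ∀ g : C(X, ℝ), J g ∈ W ↔ g ∈ M := by
    intro g
    have e1 : Complex.reCLM.compLeftContinuous ℝ X (J g) = g := by ext x; simp [J]
    have e2 : Complex.imCLM.compLeftContinuous ℝ X (J g) = 0 := by ext x; simp [J]
    change (_ ∈ M ∧ _ ∈ M) ↔ _
    rw [e1, e2]
    simp
  have hval : ((aeval (u : S) (q.map (algebraMap ℝ ℂ)) : S) : C(X, ℂ) →L[ℂ] C(X, ℂ))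
      = aeval (koop ℂ T) (q.map (algebraMap ℝ ℂ)) :=
    (aeval_algHom_apply S.val (u : S) _).symm
  have hb' : (b : C(X, ℂ) →L[ℂ] C(X, ℂ)) (aeval (koop ℂ T) (q.map (algebraMap ℝ ℂ)) (J f)) = J f := by
    have := congrArg (fun s : S => (s : C(X, ℂ) →L[ℂ] C(X, ℂ)) (J f)) hb
    rw [← hval]
    exact this
  rw [← hJW, ← hb', hJ]
  exact b.2 _ ((hJW _).2 hf)

theorem hiter_eq_zpow {X : Type*} [TopologicalSpace X] (T : X ≃ₜ X) (n : ℤ) :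
    hiter T n = T ^ n := by
  have h : ∀ m : ℕ, hiterN T m = T ^ m := by
    intro m
    induction m with
    | zero => rfl
    | succ m ih =>
      rw [pow_succ', ← ih]
      rfl
  cases n with
  | ofNat m => simpa [hiter] using h m
  | negSucc m =>
    rw [zpow_negSucc, ← h]
    rfl

/-- closed span of iterates -/
noncomputable def cspan {X : Type*} [TopologicalSpace X] [CompactSpace X] (T : X ≃ₜ X)
    (F : Set C(X, ℝ)) : Submodule ℝ C(X, ℝ) :=
  (Submodule.span ℝ (iterSet T F)).topologicalClosure

theorem subset_cspan {X : Type*} [TopologicalSpace X] [CompactSpace X] (T : X ≃ₜ X)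
    (F : Set C(X, ℝ)) (f : C(X, ℝ)) (hf : f ∈ F) : f ∈ cspan T F :=
  Submodule.le_topologicalClosure _ (Submodule.subset_span ⟨f, hf, 0, by
    rw [hiter_eq_zpow]; ext x; simp⟩)

theorem koop_mem_cspan {X : Type*} [TopologicalSpace X] [CompactSpace X] (T R : X ≃ₜ X)
    (m : ℤ) (hR : R = T ^ m)
    (F : Set C(X, ℝ)) (f : C(X, ℝ)) (hf : f ∈ cspan T F) : koop ℝ R f ∈ cspan T F := by
  have key : ∀ g ∈ Submodule.span ℝ (iterSet T F),
      koop ℝ R g ∈ Submodule.span ℝ (iterSet T F) := by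
    intro g hg
    induction hg using Submodule.span_induction with
    | mem g hg =>
      obtain ⟨f, hf, n, rfl⟩ := hg
      refine Submodule.subset_span ⟨f, hf, n + m, ?_⟩
      rw [hiter_eq_zpow, hiter_eq_zpow, zpow_add, hR]
      rfl
    | zero => simp
    | add a b _ _ ha hb => rw [map_add]; exact add_mem ha hb
    | smul c a _ ha => rw [map_smul]; exact Submodule.smul_mem _ _ ha
  exact map_mem_closure (koop ℝ R).continuous hf key

theorem aeval_mem_of_inv {X : Type*} [TopologicalSpace X] [CompactSpace X] (T : X ≃ₜ X)
    (M : Submodule ℝ C(X, ℝ)) (h1 : ∀ f ∈ M, koop ℝ T f ∈ M) (p : ℝ[X]) (f : C(X, ℝ))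
    (hf : f ∈ M) : aeval (koop ℝ T) p f ∈ M := by
  induction p using Polynomial.induction_on' with
  | add p q hp hq => rw [map_add, add_apply]; exact add_mem hp hq
  | monomial n a =>
    rw [aeval_koop_monomial]
    refine M.smul_mem _ ?_
    induction n with
    | zero => exact hf
    | succ n ih => rw [pow_succ', mul_apply_eq_comp]; exact h1 _ ih

theorem finite_eventually_ne {S : Set ℝ} (hS : S.Finite) (a : ℝ) :
    ∀ᶠ t in nhdsWithin a {a}ᶜ, t ∉ S := by
  have h1 : (S \ {a})ᶜ ∈ nhds a :=
    (hS.subset Set.sdiff_subset).isClosed.isOpen_compl.mem_nhds (by simp)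
  filter_upwards [mem_nhdsWithin_of_mem_nhds h1, self_mem_nhdsWithin] with t ht ht2 hts
  exact ht ⟨hts, ht2⟩

theorem eventually_det_ne {d : ℕ} (A : Matrix (Fin d) (Fin d) ℝ[X]) :
    ∀ᶠ t in nhdsWithin (0 : ℝ) {0}ᶜ, (A + (C t) • (1 : Matrix (Fin d) (Fin d) ℝ[X])).det ≠ 0 := by
  set A1 : Matrix (Fin d) (Fin d) ℝ := A.map (evalRingHom 1) with hA1
  have hfin : {t : ℝ | (-A1).charpoly.IsRoot t}.Finite :=
    finite_setOfPred_isRoot (Matrix.charpoly_monic _).ne_zero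
  filter_upwards [finite_eventually_ne hfin 0] with t ht h0
  apply ht
  change _ = _
  rw [Matrix.eval_charpoly]
  have := congrArg (evalRingHom (1 : ℝ)) h0
  rw [RingHom.map_det, map_zero] at this
  rw [← this]
  congr 1
  ext i j
  by_cases h : i = j
  · subst h; simp [hA1, add_comm]
  · simp [hA1, h]

theorem eventually_circle (D : ℝ[X]) (hD : D ≠ 0) :
    ∀ᶠ r in nhdsWithin (1 : ℝ) {1}ᶜ, ∀ z : ℂ, ‖z‖ = 1 → aeval z (D.comp (C r * Polynomial.X)) ≠ 0 := by
  have hD' : D.map (algebraMap ℝ ℂ) ≠ 0 :=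
    (Polynomial.map_ne_zero_iff (algebraMap ℝ ℂ).injective).2 hD
  have hfin : ((fun z : ℂ => ‖z‖) '' {z : ℂ | (D.map (algebraMap ℝ ℂ)).IsRoot z}).Finite :=
    (finite_setOfPred_isRoot hD').image _
  have hpos : ∀ᶠ r in nhdsWithin (1 : ℝ) {1}ᶜ, (0 : ℝ) < r :=
    mem_nhdsWithin_of_mem_nhds (lt_mem_nhds one_pos)
  filter_upwards [finite_eventually_ne hfin 1, hpos] with r hr hr0 z hz h0
  apply hr
  refine ⟨(r : ℂ) * z, ?_, ?_⟩
  · change eval _ _ = 0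
    rw [eval_map_algebraMap, ← h0, aeval_comp]
    simp
  · simp [hz, abs_of_pos hr0]

theorem continuous_scale {X : Type*} [TopologicalSpace X] [CompactSpace X] (T : X ≃ₜ X)
    (p : ℝ[X]) (f : C(X, ℝ)) :
    Continuous fun r : ℝ => aeval (koop ℝ T) (p.comp (C r * Polynomial.X)) f := by
  induction p using Polynomial.induction_on' with
  | add p q hp hq =>
    simp only [add_comp, map_add, add_apply]
    exact hp.add hq
  | monomial n a =>
    have : ∀ r : ℝ, (monomial n a).comp (C r * Polynomial.X) = monomial n (a * r ^ n) := by
      intro r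
      rw [monomial_comp, mul_pow, ← C_pow, ← mul_assoc, ← C_mul, C_mul_X_pow_eq_monomial]
    simp only [this, aeval_koop_monomial]
    fun_prop

theorem exists_perturb {X : Type*} [TopologicalSpace X] [CompactSpace X] (T : X ≃ₜ X) {d : ℕ}
    (e : Fin d → C(X, ℝ)) (A : Matrix (Fin d) (Fin d) ℝ[X]) (δ : ℝ) (hδ : 0 < δ) :
    ∃ f : Fin d → C(X, ℝ), (∀ i, dist (f i) (∑ k, aeval (koop ℝ T) (A i k) (e k)) < δ) ∧
      ∀ k, e k ∈ cspan T (Set.range f) := by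
  -- first perturbation
  have ht1 : ∀ᶠ t in nhdsWithin (0 : ℝ) {0}ᶜ, ∀ i, ‖t • e i‖ < δ / 2 := by
    rw [Filter.eventually_all]
    intro i
    apply Filter.Eventually.filter_mono nhdsWithin_le_nhds
    have hc : Continuous fun t : ℝ => ‖t • e i‖ := by fun_prop
    exact hc.continuousAt.eventually_lt_const (by simpa using half_pos hδ)
  obtain ⟨t, ht, htdet⟩ := (ht1.and (eventually_det_ne A)).exists
  set B := A + (C t) • (1 : Matrix (Fin d) (Fin d) ℝ[X]) with hB
  have hBA : ∀ i, ∑ k, aeval (koop ℝ T) (B i k) (e k)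
      = ∑ k, aeval (koop ℝ T) (A i k) (e k) + t • e i := by
    intro i
    have h1 : ∀ k, aeval (koop ℝ T) (B i k) (e k)
        = aeval (koop ℝ T) (A i k) (e k) + if i = k then t • e k else 0 := by
      intro k
      rw [hB, Matrix.add_apply, map_add, add_apply]
      congr 1
      rw [Matrix.smul_apply, Matrix.one_apply]
      split_ifs with h
      · rw [smul_eq_mul, mul_one, aeval_C, Algebra.algebraMap_eq_smul_one]
        rfl
      · simp
    simp only [h1, Finset.sum_add_distrib, Finset.sum_ite_eq, Finset.mem_univ, if_true]
  -- second perturbation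
  have hr1 : ∀ᶠ r in nhdsWithin (1 : ℝ) {1}ᶜ, ∀ i,
      dist (∑ k, aeval (koop ℝ T) ((B i k).comp (C r * Polynomial.X)) (e k))
        (∑ k, aeval (koop ℝ T) (B i k) (e k)) < δ / 2 := by
    rw [Filter.eventually_all]
    intro i
    apply Filter.Eventually.filter_mono nhdsWithin_le_nhds
    have hc : Continuous fun r : ℝ =>
        dist (∑ k, aeval (koop ℝ T) ((B i k).comp (C r * Polynomial.X)) (e k))
        (∑ k, aeval (koop ℝ T) (B i k) (e k)) :=
      (continuous_finsetSum _ fun k _ => continuous_scale T _ _).dist continuous_const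
    exact hc.continuousAt.eventually_lt_const (by simpa using half_pos hδ)
  obtain ⟨r, hr, hrc⟩ := (hr1.and (eventually_circle B.det htdet)).exists
  set f : Fin d → C(X, ℝ) := fun i => ∑ k, aeval (koop ℝ T) ((B i k).comp (C r * Polynomial.X)) (e k)
    with hf
  refine ⟨f, fun i => ?_, fun k => ?_⟩
  · refine (dist_triangle _ _ _).trans_lt (lt_of_lt_of_eq (add_lt_add (hr i) ?_) (add_halves δ))
    rw [hBA, dist_eq_norm, add_sub_cancel_left]
    exact ht i
  · have hinv : ∀ g ∈ cspan T (Set.range f), koop ℝ T g ∈ cspan T (Set.range f) :=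
      koop_mem_cspan T T 1 (by simp) _
    have hinv2 : ∀ g ∈ cspan T (Set.range f), koop ℝ T.symm g ∈ cspan T (Set.range f) :=
      koop_mem_cspan T T.symm (-1) (by rw [zpow_neg_one]; rfl) _
    refine mem_of_aeval_mem T _ (Submodule.isClosed_topologicalClosure _) hinv hinv2
      (B.det.comp (C r * Polynomial.X)) hrc (e k) ?_
    set B' : Matrix (Fin d) (Fin d) ℝ[X] := B.map (compRingHom (C r * Polynomial.X)) with hB'
    have hdet : B.det.comp (C r * Polynomial.X) = B'.det := by
      have := RingHom.map_det (compRingHom (C r * Polynomial.X)) B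
      exact this
    have hsum : aeval (koop ℝ T) (B.det.comp (C r * Polynomial.X)) (e k)
        = ∑ i, aeval (koop ℝ T) (B'.adjugate k i) (f i) := by
      have h2 : ∀ l, ∑ i, aeval (koop ℝ T) (B'.adjugate k i) (aeval (koop ℝ T) (B' i l) (e l))
          = if k = l then aeval (koop ℝ T) B'.det (e l) else 0 := by
        intro l
        have h3 : (B'.adjugate * B') k l = (B'.det • (1 : Matrix (Fin d) (Fin d) ℝ[X])) k l := by
          rw [Matrix.adjugate_mul]
        rw [Matrix.mul_apply, Matrix.smul_apply, Matrix.one_apply] at h3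
        have h4 := congrArg (fun p => aeval (koop ℝ T) p (e l)) h3
        simp only [map_sum, map_mul, sum_apply, mul_apply_eq_comp] at h4
        rw [h4]
        split_ifs <;> simp
      have h5 : ∀ i, aeval (koop ℝ T) (B'.adjugate k i) (f i)
          = ∑ l, aeval (koop ℝ T) (B'.adjugate k i) (aeval (koop ℝ T) (B' i l) (e l)) := by
        intro i
        rw [hf, map_sum]
        rfl
      simp only [h5]
      rw [Finset.sum_comm]
      simp only [h2, Finset.sum_ite_eq, Finset.mem_univ, if_true, hdet]
    rw [hsum]
    exact sum_mem fun i _ => aeval_mem_of_inv T _ hinv _ _ (subset_cspan T _ _ ⟨i, rfl⟩)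

/-- Laurent-polynomial-like span of the `e k` under nonnegative iterates. -/
noncomputable def polySpan {X : Type*} [TopologicalSpace X] [CompactSpace X] (T : X ≃ₜ X) {d : ℕ}
    (e : Fin d → C(X, ℝ)) : Submodule ℝ C(X, ℝ) where
  carrier := {g | ∃ p : Fin d → ℝ[X], g = ∑ k, aeval (koop ℝ T) (p k) (e k)}
  add_mem' := by
    rintro _ _ ⟨p, rfl⟩ ⟨q, rfl⟩
    exact ⟨p + q, by simp [Finset.sum_add_distrib]⟩
  zero_mem' := ⟨0, by simp⟩
  smul_mem' := by
    rintro c _ ⟨p, rfl⟩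
    exact ⟨c • p, by simp [Finset.smul_sum]⟩

theorem pow_mem_polySpan {X : Type*} [TopologicalSpace X] [CompactSpace X] (T : X ≃ₜ X) {d : ℕ}
    (e : Fin d → C(X, ℝ)) (k : Fin d) (j : ℕ) : (koop ℝ T ^ j) (e k) ∈ polySpan T e := by
  refine ⟨Pi.single k (Polynomial.X ^ j), ?_⟩
  rw [Finset.sum_eq_single k]
  · simp
  · intro b _ hb
    simp [Pi.single_eq_of_ne hb]
  · simp

/-- Indicators of the bases of a partition, padded by zero. -/
noncomputable def baseFn {X : Type*} [TopologicalSpace X] {T : X ≃ₜ X} (d : ℕ)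
    (Q : KRPartition X T) (k : Fin d) : C(X, ℝ) :=
  if h : (k : ℕ) < Q.d then
    (LocallyConstant.charFn ℝ (Q.isClopen ⟨k, h⟩) : C(X, ℝ)) else 0

theorem refine_le {X : Type*} [TopologicalSpace X] {T : X ≃ₜ X} (P : ℕ → KRPartition X T)
    (href : ∀ n, ∀ k : Fin (P (n + 1)).d, ∀ j : ℕ, j < (P (n + 1)).h k →
      ∃ k' : Fin (P n).d, ∃ j' : ℕ, j' < (P n).h k' ∧
        (⇑T)^[j] ⁻¹' ((P (n + 1)).B k) ⊆ (⇑T)^[j'] ⁻¹' ((P n).B k'))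
    (n N : ℕ) (hnN : n ≤ N) : ∀ k : Fin (P N).d, ∀ j : ℕ, j < (P N).h k →
      ∃ k' : Fin (P n).d, ∃ j' : ℕ, j' < (P n).h k' ∧
        (⇑T)^[j] ⁻¹' ((P N).B k) ⊆ (⇑T)^[j'] ⁻¹' ((P n).B k') := by
  induction N, hnN using Nat.le_induction with
  | base => exact fun k j hj => ⟨k, j, hj, subset_rfl⟩
  | succ N _ ih =>
    intro k j hj
    obtain ⟨k1, j1, h1, h2⟩ := href N k j hj
    obtain ⟨k2, j2, h3, h4⟩ := ih k1 j1 h1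
    exact ⟨k2, j2, h3, h2.trans h4⟩

theorem exists_approx {X : Type*} [TopologicalSpace X] [CompactSpace X] (T : X ≃ₜ X) (d : ℕ)
    (P : ℕ → KRPartition X T) (hd : ∀ n, (P n).d ≤ d)
    (href : ∀ n, ∀ k : Fin (P (n + 1)).d, ∀ j : ℕ, j < (P (n + 1)).h k →
      ∃ k' : Fin (P n).d, ∃ j' : ℕ, j' < (P n).h k' ∧
        (⇑T)^[j] ⁻¹' ((P (n + 1)).B k) ⊆ (⇑T)^[j'] ⁻¹' ((P n).B k'))
    (hspan : ∀ U : Set X, IsOpen U → ∀ x ∈ U, ∃ n : ℕ, 1 ≤ n ∧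
      ∃ k : Fin (P n).d, ∃ j : ℕ, j < (P n).h k ∧
        x ∈ (⇑T)^[j] ⁻¹' ((P n).B k) ∧ (⇑T)^[j] ⁻¹' ((P n).B k) ⊆ U)
    (g : C(X, ℝ)) (ε : ℝ) (hε : 0 < ε) :
    ∃ N0 : ℕ, ∀ N, N0 ≤ N → ∃ g' ∈ polySpan T (baseFn d (P N)), dist g' g < ε := by
  have hx : ∀ x : X, ∃ n : ℕ, ∃ k : Fin (P n).d, ∃ j : ℕ, j < (P n).h k ∧
        x ∈ (⇑T)^[j] ⁻¹' ((P n).B k) ∧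
        (⇑T)^[j] ⁻¹' ((P n).B k) ⊆ {y | dist (g x) (g y) < ε} := by
    intro x
    obtain ⟨n, -, h⟩ := hspan {y | dist (g x) (g y) < ε}
      (isOpen_lt (by fun_prop) continuous_const) x (by simpa using hε)
    exact ⟨n, h⟩
  choose n k j hj hmem hsub using hx
  obtain ⟨t, ht⟩ := isCompact_univ.elim_nhds_subcover
    (fun x => (⇑T)^[j x] ⁻¹' ((P (n x)).B (k x))) (fun x _ =>
      (((P (n x)).isClopen (k x)).isOpen.preimage (T.continuous.iterate _)).mem_nhds (hmem x))
  refine ⟨t.sup n, fun N hN => ?_⟩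
  have hval : ∀ l : Fin (P N).d, ∀ i : ℕ, ∃ a : ℝ, i < (P N).h l →
      ∀ y ∈ (⇑T)^[i] ⁻¹' ((P N).B l), dist a (g y) < ε := by
    intro l i
    by_cases hi : i < (P N).h l
    · rcases Set.eq_empty_or_nonempty ((⇑T)^[i] ⁻¹' ((P N).B l)) with h0 | ⟨y0, hy0⟩
      · exact ⟨0, fun _ y hy => by rw [h0] at hy; exact hy.elim⟩
      · obtain ⟨x, hxt, hxy⟩ := Set.mem_iUnion₂.1 (ht.2 (Set.mem_univ y0))
        refine ⟨g x, fun _ y hy => hsub x ?_⟩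
        obtain ⟨k', j', hj', hs⟩ := refine_le P href (n x) N
          ((Finset.le_sup hxt).trans hN) l i hi
        by_cases heq : (k x, j x) = (k', j')
        · rw [Prod.mk.injEq] at heq
          rw [heq.1, heq.2]
          exact hs hy
        · exact (Set.disjoint_left.1 ((P (n x)).disjoint _ _ _ _ (hj x) hj' heq) hxy
            (hs hy0)).elim
    · exact ⟨0, fun h => (hi h).elim⟩
  choose a ha using hval
  have hbase : ∀ (l : Fin (P N).d) (i : ℕ) (y : X),
      (koop ℝ T ^ i) (baseFn d (P N) (Fin.castLE (hd N) l)) y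
        = Set.indicator ((⇑T)^[i] ⁻¹' ((P N).B l)) 1 y := by
    intro l i y
    rw [koop_pow_apply]
    have : baseFn d (P N) (Fin.castLE (hd N) l)
        = (LocallyConstant.charFn ℝ ((P N).isClopen l) : C(X, ℝ)) := by
      simp [baseFn]
    rw [this]
    change (LocallyConstant.charFn ℝ ((P N).isClopen l) : X → ℝ) _ = _
    rw [LocallyConstant.coe_charFn]
    rfl
  refine ⟨∑ l : Fin (P N).d, ∑ i ∈ Finset.range ((P N).h l),
    a l i • (koop ℝ T ^ i) (baseFn d (P N) (Fin.castLE (hd N) l)), ?_, ?_⟩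
  · exact sum_mem fun l _ => sum_mem fun i _ => Submodule.smul_mem _ _ (pow_mem_polySpan _ _ _ _)
  · refine (ContinuousMap.dist_lt_iff hε).2 fun y => ?_
    have hy : y ∈ ⋃ k, ⋃ j ∈ Finset.range ((P N).h k), (⇑T)^[j] ⁻¹' ((P N).B k) := by
      rw [(P N).cover]; trivial
    simp only [Set.mem_iUnion, Finset.mem_range, exists_prop] at hy
    obtain ⟨l0, i0, hi0, hy0⟩ := hy
    have hz : ∀ l i, i < (P N).h l → (l, i) ≠ (l0, i0) →
        Set.indicator ((⇑T)^[i] ⁻¹' ((P N).B l)) (1 : X → ℝ) y = 0 := by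
      intro l i hi hne
      exact Set.indicator_of_notMem
        (fun hm => Set.disjoint_left.1 ((P N).disjoint _ _ _ _ hi hi0 hne) hm hy0) _
    simp only [ContinuousMap.sum_apply, ContinuousMap.smul_apply, hbase]
    rw [Finset.sum_eq_single l0, Finset.sum_eq_single i0]
    · rw [Set.indicator_of_mem hy0]
      simpa using ha l0 i0 hi0 y hy0
    · intro i hi hne
      rw [hz l0 i (Finset.mem_range.1 hi) (by simp [hne]), smul_zero]
    · intro h
      exact (h (Finset.mem_range.2 hi0)).elim
    · intro l _ hne
      refine Finset.sum_eq_zero fun i hi => ?_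
      rw [hz l i (Finset.mem_range.1 hi) (by simp [hne]), smul_zero]
    · simp

/-- Tuples whose span approximates `g` up to `ε`. -/
def goodSet {X : Type*} [TopologicalSpace X] [CompactSpace X] (T : X ≃ₜ X) (d : ℕ)
    (g : C(X, ℝ)) (ε : ℝ) : Set (Fin d → C(X, ℝ)) :=
  {f | ∃ s ∈ Submodule.span ℝ (iterSet T (Set.range f)), dist s g < ε}

theorem isOpen_goodSet {X : Type*} [TopologicalSpace X] [CompactSpace X] (T : X ≃ₜ X) (d : ℕ)
    (g : C(X, ℝ)) (ε : ℝ) : IsOpen (goodSet T d g ε) := by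
  rw [isOpen_iff_mem_nhds]
  rintro f0 ⟨s, hs, hsg⟩
  have key : ∃ Φ : (Fin d → C(X, ℝ)) → C(X, ℝ), Continuous Φ ∧ Φ f0 = s ∧
      ∀ f, Φ f ∈ Submodule.span ℝ (iterSet T (Set.range f)) := by
    clear hsg
    induction hs using Submodule.span_induction with
    | mem s hs =>
      obtain ⟨_, ⟨i, rfl⟩, n, rfl⟩ := hs
      refine ⟨fun f => koop ℝ (hiter T n) (f i), by fun_prop, rfl, fun f => ?_⟩
      exact Submodule.subset_span ⟨f i, ⟨i, rfl⟩, n, rfl⟩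
    | zero => exact ⟨fun _ => 0, continuous_const, rfl, fun _ => zero_mem _⟩
    | add a b _ _ ha hb =>
      obtain ⟨Φ, h1, h2, h3⟩ := ha
      obtain ⟨Ψ, h4, h5, h6⟩ := hb
      exact ⟨fun f => Φ f + Ψ f, h1.add h4, by simp only [h2, h5], fun f => add_mem (h3 f) (h6 f)⟩
    | smul c a _ ha =>
      obtain ⟨Φ, h1, h2, h3⟩ := ha
      exact ⟨fun f => c • Φ f, h1.const_smul c, by simp only [h2], fun f =>
        Submodule.smul_mem _ _ (h3 f)⟩
  obtain ⟨Φ, h1, h2, h3⟩ := key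
  have : Φ ⁻¹' Metric.ball g ε ∈ nhds f0 :=
    (Metric.isOpen_ball.preimage h1).mem_nhds (by simpa [h2] using hsg)
  filter_upwards [this] with f hf
  exact ⟨Φ f, h3 f, hf⟩

theorem dense_goodSet {X : Type*} [TopologicalSpace X] [CompactSpace X] (T : X ≃ₜ X) (d : ℕ)
    (P : ℕ → KRPartition X T) (hd : ∀ n, (P n).d ≤ d)
    (href : ∀ n, ∀ k : Fin (P (n + 1)).d, ∀ j : ℕ, j < (P (n + 1)).h k →
      ∃ k' : Fin (P n).d, ∃ j' : ℕ, j' < (P n).h k' ∧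
        (⇑T)^[j] ⁻¹' ((P (n + 1)).B k) ⊆ (⇑T)^[j'] ⁻¹' ((P n).B k'))
    (hspan : ∀ U : Set X, IsOpen U → ∀ x ∈ U, ∃ n : ℕ, 1 ≤ n ∧
      ∃ k : Fin (P n).d, ∃ j : ℕ, j < (P n).h k ∧
        x ∈ (⇑T)^[j] ⁻¹' ((P n).B k) ∧ (⇑T)^[j] ⁻¹' ((P n).B k) ⊆ U)
    (g : C(X, ℝ)) (ε : ℝ) (hε : 0 < ε) : Dense (goodSet T d g ε) := by
  rw [Metric.dense_iff]
  intro f0 δ hδ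
  obtain ⟨N1, hN1⟩ := exists_approx T d P hd href hspan g (ε / 2) (half_pos hε)
  have h2 := fun i => exists_approx T d P hd href hspan (f0 i) (δ / 2) (half_pos hδ)
  choose N2 hN2 using h2
  set N := max N1 (Finset.univ.sup N2) with hN
  obtain ⟨g', ⟨c, hc⟩, hgg⟩ := hN1 N (le_max_left _ _)
  have h3 := fun i => hN2 i N ((Finset.le_sup (Finset.mem_univ i)).trans (le_max_right _ _))
  choose f' hf' hff using h3
  choose A hA using hf'
  obtain ⟨f, hf1, hf2⟩ := exists_perturb T (baseFn d (P N)) A (δ / 2) (half_pos hδ)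
  refine ⟨f, ?_, ?_⟩
  · rw [Metric.mem_ball, dist_pi_lt_iff hδ]
    intro i
    refine (dist_triangle _ (f' i) _).trans_lt
      (lt_of_lt_of_eq (add_lt_add ?_ (hff i)) (add_halves δ))
    rw [hA i]
    exact hf1 i
  · have hg' : g' ∈ cspan T (Set.range f) := by
      rw [hc]
      exact sum_mem fun k _ => aeval_mem_of_inv T _
        (koop_mem_cspan T T 1 (by simp) _) _ _ (hf2 k)
    obtain ⟨s, hs, hsg⟩ := Metric.mem_closure_iff.1 hg' (ε / 2) (half_pos hε)
    refine ⟨s, hs, (dist_triangle _ g' _).trans_lt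
      (lt_of_lt_of_eq (add_lt_add ?_ hgg) (add_halves ε))⟩
    rwa [dist_comm]

end MultRank

/-- **Topological multiplicity is at most the topological rank.**
Let `(X, T)` be a minimal Cantor system (`X` compact, metrizable, totally disconnected,
without isolated points; all `T`-orbits dense) admitting a primitive sequence of nested
Kakutani–Rohlin partitions `P n` with `(P n).d ≤ d` for all `n`, i.e. of topological rank
at most `d`.  Then there is a set `F ⊆ C(X)` with at most `d` elements whose iterates
`f ∘ Tⁿ`, `n ∈ ℤ`, span a dense subspace of `C(X)`; that is, `Mult(T) ≤ d`. -/
theorem mult_le_topological_rank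
    {X : Type*} [TopologicalSpace X] [CompactSpace X] [TopologicalSpace.MetrizableSpace X]
    [TotallyDisconnectedSpace X]
    (hno_isolated : ∀ x : X, ¬ IsOpen ({x} : Set X))
    (T : X ≃ₜ X)
    (hmin : ∀ x : X, Dense (Set.range fun n : ℤ => hiter T n x))
    (d : ℕ)
    (P : ℕ → KRPartition X T)
    (hd : ∀ n, (P n).d ≤ d)
    -- (1) the 0-th partition is trivial
    (h0 : (P 0).d = 1 ∧ (∀ k, (P 0).h k = 1) ∧ (∀ k, (P 0).B k = Set.univ))
    -- (2) the bases are nested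
    (hbase : ∀ n, (P (n + 1)).base ⊆ (P n).base)
    -- (3) each partition refines the previous one
    (href : ∀ n, ∀ k : Fin (P (n + 1)).d, ∀ j : ℕ, j < (P (n + 1)).h k →
      ∃ k' : Fin (P n).d, ∃ j' : ℕ, j' < (P n).h k' ∧
        (⇑T)^[j] ⁻¹' ((P (n + 1)).B k) ⊆ (⇑T)^[j'] ⁻¹' ((P n).B k'))
    -- (4) the intersection of the bases is a single point
    (hsingle : ∃ x : X, (⋂ n, (P n).base) = {x})
    -- (5) the partitions span the topology of `X`
    (hspan : ∀ U : Set X, IsOpen U → ∀ x ∈ U, ∃ n : ℕ, 1 ≤ n ∧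
      ∃ k : Fin (P n).d, ∃ j : ℕ, j < (P n).h k ∧
        x ∈ (⇑T)^[j] ⁻¹' ((P n).B k) ∧ (⇑T)^[j] ⁻¹' ((P n).B k) ⊆ U)
    -- primitivity
    (hprim : ∀ n : ℕ, 1 ≤ n → ∃ N : ℕ, n < N ∧
      ∀ k : Fin (P N).d, ∀ x ∈ (⇑T)^[(P N).h k - 1] ⁻¹' ((P N).B k),
        ∀ j : Fin (P n).d, ∃ i : ℕ, i ≤ (P N).h k - 1 ∧ (⇑T)^[i] x ∈ (P n).B j) :
    ∃ F : Finset C(X, ℝ), F.card ≤ d ∧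
      Dense (Submodule.span ℝ (iterSet T (F : Set C(X, ℝ))) : Set C(X, ℝ)) := by
  classical
  letI : MetricSpace X := TopologicalSpace.metrizableSpaceMetric X
  have hdense : Dense (⋂ p : ℕ × ℕ, goodSet T d (TopologicalSpace.denseSeq C(X, ℝ) p.1)
      (1 / ((p.2 : ℝ) + 1))) :=
    dense_iInter_of_isOpen (fun p => isOpen_goodSet T d _ _)
      (fun p => dense_goodSet T d P hd href hspan _ _ (by positivity))
  obtain ⟨f, hf⟩ := hdense.nonempty
  refine ⟨Finset.univ.image f, Finset.card_image_le.trans (by simp), ?_⟩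
  rw [Finset.coe_image, Finset.coe_univ, Set.image_univ, Metric.dense_iff]
  intro g ε hε
  obtain ⟨_, hn, n, rfl⟩ := Metric.dense_iff.1 (TopologicalSpace.denseRange_denseSeq C(X, ℝ)) g
    (ε / 2) (half_pos hε)
  obtain ⟨m, hm⟩ := exists_nat_one_div_lt (half_pos hε)
  obtain ⟨s, hs, hsg⟩ := Set.mem_iInter.1 hf (n, m)
  refine ⟨s, ?_, hs⟩
  rw [Metric.mem_ball]
  exact (dist_triangle _ _ _).trans_lt
    (lt_of_lt_of_eq (add_lt_add (hsg.trans hm) hn) (add_halves ε))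
end

section
/- Let u ∈ {0,1}^ℤ be a Sturmian word: u is recurrent under the shift σ and for every n ≥ 1 the number of distinct words of length n occurring in u equals n + 1. Let X_u be the closure of the shift-orbit of u in {0,1}^ℤ. Then the subshift (X_u, σ) is topologically simple: there exists f ∈ C(X_u) such that the linear span of {f ∘ σⁿ : n ∈ ℤ} is dense in C(X_u). -/
/-- The shift by `k ∈ ℤ` on the space `ℤ → A` of bilateral sequences:
`(σᵏ x) n = x (n + k)`.  For `k = 1` this is the usual left shift `σ`. -/
def shiftZ (A : Type*) [TopologicalSpace A] (k : ℤ) : (ℤ → A) ≃ₜ (ℤ → A) where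
  toFun x n := x (n + k)
  invFun x n := x (n - k)
  left_inv x := funext fun n => congrArg x (by ring)
  right_inv x := funext fun n => congrArg x (by ring)
  continuous_toFun := continuous_pi fun n => continuous_apply (n + k)
  continuous_invFun := continuous_pi fun n => continuous_apply (n - k)

/-- The closure of the (bilateral) shift-orbit of a point `u : ℤ → A`. -/
def orbitClosure {A : Type*} [TopologicalSpace A] (u : ℤ → A) : Set (ℤ → A) :=
  closure {x : ℤ → A | ∃ k : ℤ, x = shiftZ A k u}

/-- The orbit closure of `u` is invariant under every power of the shift. -/
lemma shiftZ_mem_orbitClosure {A : Type*} [TopologicalSpace A] (u : ℤ → A) (k : ℤ)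
    {x : ℤ → A} (hx : x ∈ orbitClosure u) : shiftZ A k x ∈ orbitClosure u := by
  refine map_mem_closure (shiftZ A k).continuous hx ?_
  rintro y ⟨m, rfl⟩
  exact ⟨m + k, funext fun n => congrArg u (by ring)⟩

def eqw (u : ℤ → Fin 2) (a b : ℤ) (N : ℕ) : Prop := ∀ i : ℕ, i < N → u (a + i) = u (b + i)

def special (u : ℤ → Fin 2) (a : ℤ) (N : ℕ) : Prop := ∃ b, eqw u a b N ∧ u (a + N) ≠ u (b + N)

def wd (u : ℤ → Fin 2) (N : ℕ) (a : ℤ) : Fin N → Fin 2 := fun i => u (a + ((i : ℕ) : ℤ))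

/-- number of ones in the window of length `m` starting at `k` -/
def cnt (u : ℤ → Fin 2) (k : ℤ) (m : ℕ) : ℤ := ∑ i ∈ Finset.range m, ((u (k + i)).val : ℤ)

lemma wd_eq_iff (u : ℤ → Fin 2) (N : ℕ) (a b : ℤ) : wd u N a = wd u N b ↔ eqw u a b N := by
  constructor
  · intro h i hi
    exact congrFun h ⟨i, hi⟩
  · intro h
    funext i
    exact h i i.2

lemma eqw.symm {u : ℤ → Fin 2} {a b : ℤ} {N : ℕ} (h : eqw u a b N) : eqw u b a N :=
  fun i hi => (h i hi).symm

lemma eqw.trans {u : ℤ → Fin 2} {a b c : ℤ} {N : ℕ} (h : eqw u a b N) (h' : eqw u b c N) :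
    eqw u a c N :=
  fun i hi => (h i hi).trans (h' i hi)

lemma special.congr {u : ℤ → Fin 2} {a b : ℤ} {N : ℕ} (hs : special u a N) (h : eqw u a b N) :
    special u b N := by
  obtain ⟨c, hc, hne⟩ := hs
  by_cases hb : u (b + N) = u (a + N)
  · exact ⟨c, h.symm.trans hc, by rwa [hb]⟩
  · exact ⟨a, h.symm, hb⟩

lemma eqw_next {u : ℤ → Fin 2} {a b : ℤ} {N : ℕ} (h : eqw u a b N) (hs : ¬ special u a N) :
    eqw u (a + 1) (b + 1) N := by
  have hN : u (a + N) = u (b + N) := by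
    by_contra hne
    exact hs ⟨b, h, hne⟩
  intro i hi
  have e1 : a + 1 + (i : ℤ) = a + ((i + 1 : ℕ) : ℤ) := by push_cast; ring
  have e2 : b + 1 + (i : ℤ) = b + ((i + 1 : ℕ) : ℤ) := by push_cast; ring
  rw [e1, e2]
  rcases Nat.lt_or_ge (i + 1) N with h1 | h1
  · exact h _ h1
  · have : i + 1 = N := by omega
    rw [this]; exact hN

lemma special_next {u : ℤ → Fin 2} {a : ℤ} {N : ℕ} (hs : special u a (N + 1)) :
    special u (a + 1) N := by
  obtain ⟨b, hb, hne⟩ := hs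
  refine ⟨b + 1, ?_, ?_⟩
  · intro i hi
    have := hb (i + 1) (by omega)
    have e1 : a + 1 + (i : ℤ) = a + ((i + 1 : ℕ) : ℤ) := by push_cast; ring
    have e2 : b + 1 + (i : ℤ) = b + ((i + 1 : ℕ) : ℤ) := by push_cast; ring
    rw [e1, e2]; exact this
  · have e1 : a + 1 + (N : ℤ) = a + ((N + 1 : ℕ) : ℤ) := by push_cast; ring
    have e2 : b + 1 + (N : ℤ) = b + ((N + 1 : ℕ) : ℤ) := by push_cast; ring
    rw [e1, e2]; exact hne

lemma eqw_mono {u : ℤ → Fin 2} {a b : ℤ} {N M : ℕ} (h : eqw u a b N) (hM : M ≤ N) :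
    eqw u a b M := fun i hi => h i (lt_of_lt_of_le hi hM)

section
variable {u : ℤ → Fin 2} (hc : ∀ n, (Set.range (wd u n)).ncard = n + 1)
include hc

lemma special_exists (N : ℕ) : ∃ a, special u a N := by
  by_contra hno
  push Not at hno
  have key : (Set.range (wd u (N + 1))).ncard ≤ (Set.range (wd u N)).ncard := by
    refine Set.ncard_le_ncard_of_injOn (fun w i => w i.castSucc) ?_ ?_ (Set.toFinite _)
    · rintro _ ⟨a, rfl⟩
      exact ⟨a, rfl⟩
    · rintro _ ⟨a, rfl⟩ _ ⟨b, rfl⟩ hab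
      have h1 : eqw u a b N := (wd_eq_iff u N a b).1 hab
      rw [wd_eq_iff]
      intro i hi
      rcases Nat.lt_succ_iff_lt_or_eq.1 hi with h | rfl
      · exact h1 i h
      · by_contra hne
        exact hno a ⟨b, h1, hne⟩
  rw [hc, hc] at key
  omega

lemma special_unique {N : ℕ} {a b : ℤ} (ha : special u a N) (hb : special u b N) :
    eqw u a b N := by
  by_contra hne
  set S : Set (Fin (N + 1) → Fin 2) :=
    (Set.range (wd u (N + 1)) \ {wd u (N+1) a}) \ {wd u (N+1) b} with hS
  have hneq : wd u (N + 1) b ≠ wd u (N + 1) a := by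
    intro h
    exact hne (eqw_mono ((wd_eq_iff _ _ _ _).1 h) (Nat.le_succ N)).symm
  have hcard : S.ncard = N := by
    rw [hS, Set.ncard_sdiff_singleton_of_mem, Set.ncard_sdiff_singleton_of_mem, hc]
    · omega
    · exact ⟨a, rfl⟩
    · exact ⟨⟨b, rfl⟩, hneq⟩
  have hsub : Set.range (wd u N) ⊆
      Set.image (fun (w : Fin (N+1) → Fin 2) (i : Fin N) => w i.castSucc) S := by
    rintro _ ⟨k, rfl⟩
    have : ∃ k', eqw u k k' N ∧ ¬ eqw u k' a (N+1) ∧ ¬ eqw u k' b (N+1) := by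
      by_cases h1 : eqw u k a N
      · obtain ⟨a', h, h'⟩ := ha
        refine ⟨a', h1.trans h, fun e => h' (e N (Nat.lt_succ_self N)).symm, fun e => hne ?_⟩
        exact h.trans (eqw_mono e (Nat.le_succ N))
      · by_cases h2 : eqw u k b N
        · obtain ⟨a', h, h'⟩ := hb
          refine ⟨a', h2.trans h, fun e => hne ?_, fun e => h' (e N (Nat.lt_succ_self N)).symm⟩
          exact (h.trans (eqw_mono e (Nat.le_succ N))).symm
        · exact ⟨k, fun _ _ => rfl, fun e => h1 (eqw_mono e (Nat.le_succ N)),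
            fun e => h2 (eqw_mono e (Nat.le_succ N))⟩
    obtain ⟨k', h1, h2, h3⟩ := this
    refine ⟨wd u (N+1) k', ⟨⟨⟨k', rfl⟩, fun h => h2 ((wd_eq_iff _ _ _ _).1 h)⟩,
      fun h => h3 ((wd_eq_iff _ _ _ _).1 h)⟩, ?_⟩
    exact (wd_eq_iff u N k' k).2 h1.symm
  have h1 := Set.ncard_le_ncard hsub (Set.toFinite _)
  have h2 := Set.ncard_image_le (f := fun (w : Fin (N+1) → Fin 2) (i : Fin N) => w i.castSucc)
    (Set.toFinite S)
  rw [hc] at h1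
  omega

variable (hr : ∀ (a : ℤ) (N : ℕ) (B : ℤ), ∃ b, B ≤ b ∧ eqw u a b N)
include hr

lemma no_pal {p q : ℤ} {N : ℕ} (hN : 1 ≤ N) (h0 : u p ≠ u q)
    (heq : ∀ i : ℕ, 1 ≤ i → i < N → u (p + i) = u (q + i))
    (hpN : u (p + N) = u p)
    (hpal : ∀ i : ℕ, 1 ≤ i → i < N → u (p + i) = u (p + (N - i : ℕ)))
    (hs : special u q N) : False := by
  have claim : ∀ j : ℕ, j ≤ N → ¬ eqw u (p + j) q N := by
    intro j hj he
    rcases Nat.eq_zero_or_pos j with rfl | hj0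
    · have := he 0 (by omega)
      simp at this
      exact h0 this
    rcases Nat.lt_or_ge j N with hjN | hjN
    · have e1 := he 0 (by omega)
      have e2 := he (N - j) (by omega)
      have e3 := heq (N - j) (by omega) (by omega)
      have e4 := hpal j (by omega) hjN
      have e5 : p + (j : ℤ) + ((N - j : ℕ) : ℤ) = p + N := by omega
      rw [e5] at e2
      simp only [Nat.cast_zero, add_zero] at e1
      apply h0
      rw [← hpN, e2, ← e3, ← e4, e1]
    · have : j = N := by omega
      subst this
      have e1 := he 0 (by omega)
      simp only [Nat.cast_zero, add_zero] at e1
      exact h0 (by rw [← hpN, e1])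
  have hns : ∀ j : ℕ, j ≤ N → ¬ special u (p + j) N := fun j hj h =>
    claim j hj (special_unique hc h hs)
  obtain ⟨i, j, hij, hjN, hE⟩ : ∃ i j : ℕ, i < j ∧ j ≤ N ∧ eqw u (p + i) (p + j) N := by
    by_contra hno
    push Not at hno
    have hinj : Set.InjOn (fun j : ℕ => wd u N (p + j)) (Set.Iic N) := by
      intro i hi j hj h
      have h' := (wd_eq_iff _ _ _ _).1 h
      rcases lt_trichotomy i j with h1 | h1 | h1
      · exact absurd h' (hno i j h1 hj)
      · exact h1
      · exact absurd h'.symm (hno j i h1 hi)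
    have h1 := Set.ncard_le_ncard_of_injOn (t := Set.range (wd u N) \ {wd u N q}) _ (by
      intro j hj
      exact ⟨⟨_, rfl⟩, fun h => claim j hj ((wd_eq_iff _ _ _ _).1 h)⟩) hinj (Set.toFinite _)
    rw [Set.ncard_sdiff_singleton_of_mem (Set.mem_range_self q), hc] at h1
    have : (Set.Iic N).ncard = N + 1 := by
      rw [← Finset.coe_Iic, Set.ncard_coe_finset]; simp
    omega
  have hall : ∀ t : ℕ, ∃ s : ℕ, i ≤ s ∧ s < j ∧ eqw u (p + i + t) (p + s) N := by
    intro t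
    induction t with
    | zero => exact ⟨i, le_rfl, hij, by simp; exact fun _ _ => rfl⟩
    | succ t ih =>
      obtain ⟨s, h1, h2, h3⟩ := ih
      have h4 := (eqw_next h3.symm (hns s (by omega))).symm
      have e1 : p + (i : ℤ) + (t : ℤ) + 1 = p + i + ((t + 1 : ℕ) : ℤ) := by push_cast; ring
      have e2 : p + (s : ℤ) + 1 = p + ((s + 1 : ℕ) : ℤ) := by push_cast; ring
      rw [e1, e2] at h4
      rcases Nat.lt_or_ge (s + 1) j with h5 | h5
      · exact ⟨s + 1, by omega, h5, h4⟩
      · have : s + 1 = j := by omega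
        rw [this] at h4
        exact ⟨i, le_rfl, hij, h4.trans hE.symm⟩
  obtain ⟨b, hb, hbe⟩ := hr q N (p + i)
  obtain ⟨t, ht⟩ := Int.le.dest hb
  obtain ⟨s, h1, h2, h3⟩ := hall t
  rw [ht] at h3
  exact claim s (by omega) (hbe.trans h3).symm

lemma balanced (m : ℕ) : ∀ k l : ℤ, cnt u k m ≤ cnt u l m + 1 := by
  induction m using Nat.strong_induction_on with
  | _ m ih =>
  intro p q
  by_contra hbad
  push Not at hbad
  have cadd : ∀ (k : ℤ) (a b : ℕ), cnt u k (a + b) = cnt u k a + cnt u (k + a) b := by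
    intro k a b
    unfold cnt
    rw [Finset.sum_range_add]
    congr 1
    refine Finset.sum_congr rfl fun i _ => ?_
    push_cast
    rw [add_assoc]
  have c0 : ∀ k : ℤ, cnt u k 0 = 0 := fun k => by simp [cnt]
  have c1 : ∀ k : ℤ, cnt u k 1 = (u k).val := fun k => by simp [cnt]
  have v1 : ∀ k, (0 : ℤ) ≤ (u k).val ∧ ((u k).val : ℤ) ≤ 1 := fun k => by omega
  have hD : ∀ i : ℕ, 1 ≤ i → i < m → cnt u p i = cnt u q i + 1 := by
    intro i h1 h2
    have a1 := ih i h2 p q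
    have a2 := ih (m - i) (by omega) (p + i) (q + i)
    have a3 := cadd p i (m - i)
    have a4 := cadd q i (m - i)
    have e : i + (m - i) = m := by omega
    rw [e] at a3 a4
    omega
  have hm2 : 2 ≤ m := by
    rcases Nat.lt_or_ge m 2 with h | h
    · interval_cases m
      · simp [c0] at hbad; 
      · have := v1 p; have := v1 q; rw [c1, c1] at hbad; omega
    · exact h
  obtain ⟨N, rfl⟩ : ∃ N, m = N + 1 := ⟨m - 1, by omega⟩
  have hN : 1 ≤ N := by omega
  have hp0 : ((u p).val : ℤ) = 1 ∧ ((u q).val : ℤ) = 0 := by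
    have := hD 1 le_rfl (by omega)
    have := v1 p; have := v1 q; rw [c1, c1] at *; omega
  have heq : ∀ i : ℕ, 1 ≤ i → i < N → u (p + i) = u (q + i) := by
    intro i h1 h2
    have a1 := hD i h1 (by omega)
    have a2 := hD (i + 1) (by omega) (by omega)
    rw [cadd, cadd, c1, c1] at a2
    apply Fin.ext
    omega
  have hlast : ((u (p + N)).val : ℤ) = 1 ∧ ((u (q + N)).val : ℤ) = 0 := by
    have a1 := hD N hN (by omega)
    rw [cadd, cadd, c1, c1] at hbad
    have := v1 (p + N); have := v1 (q + N)
    omega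
  have htot : cnt u p (N + 1) = cnt u q (N + 1) + 2 := by
    have a1 := hD N hN (by omega)
    rw [cadd, cadd, c1, c1]
    omega
  -- suffixes of length i
  have hE : ∀ i : ℕ, 1 ≤ i → i ≤ N → cnt u p i = cnt u (p + (N + 1 - i : ℕ)) i := by
    intro i h1 h2
    have a1 := ih i (by omega) p (q + (N + 1 - i : ℕ))
    have a2 := ih i (by omega) (p + (N + 1 - i : ℕ)) q
    have a3 := hD i h1 (by omega)
    have a4 := hD (N + 1 - i) (by omega) (by omega)
    have a5 := cadd p (N + 1 - i) i
    have a6 := cadd q (N + 1 - i) i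
    have e : N + 1 - i + i = N + 1 := by omega
    rw [e] at a5 a6
    omega
  have hpal : ∀ i : ℕ, 1 ≤ i → i < N → u (p + i) = u (p + (N - i : ℕ)) := by
    intro i h1 h2
    have a1 := hE i h1 (by omega)
    have a2 := hE (i + 1) (by omega) (by omega)
    have a3 := cadd p i 1
    have a4 := cadd (p + (N - i : ℕ)) 1 i
    have e1 : N + 1 - (i + 1) = N - i := by omega
    have e2 : p + ((N - i : ℕ) : ℤ) + ((1 : ℕ) : ℤ) = p + ((N + 1 - i : ℕ) : ℤ) := by omega
    rw [e1] at a2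
    rw [e2, add_comm 1 i] at a4
    rw [c1] at a3 a4
    apply Fin.ext
    omega
  have hne : u p ≠ u q := by
    intro h; rw [h] at hp0; omega
  have hpN : u (p + N) = u p := by apply Fin.ext; omega
  have hqN : u (q + N) = u q := by apply Fin.ext; omega
  obtain ⟨N', rfl⟩ : ∃ N', N = N' + 1 := ⟨N - 1, by omega⟩
  obtain ⟨a, ha⟩ := special_exists hc (N' + 1)
  have hsp : special u (p + 1) N' := by
    refine ⟨q + 1, ?_, ?_⟩
    · intro i hi
      have := heq (i + 1) (by omega) (by omega)
      push_cast at this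
      rw [add_assoc, add_assoc, add_comm (1 : ℤ)]; exact this
    · push_cast at hpN hqN
      rw [add_assoc, add_assoc, add_comm (1 : ℤ), hpN, hqN]; exact hne
  have hae := special_unique hc (special_next ha) hsp
  have hcase : u a = u p ∨ u a = u q := by
    have := v1 a
    rcases (show ((u a).val : ℤ) = 1 ∨ ((u a).val : ℤ) = 0 by omega) with h | h
    · left; apply Fin.ext; omega
    · right; apply Fin.ext; omega
  have hae' : ∀ i : ℕ, 1 ≤ i → i < N' + 1 → u (a + i) = u (p + i) := by
    intro i h1 h2
    have := hae (i - 1) (by omega)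
    have e1 : a + 1 + ((i - 1 : ℕ) : ℤ) = a + i := by omega
    have e2 : p + 1 + ((i - 1 : ℕ) : ℤ) = p + i := by omega
    rwa [e1, e2] at this
  rcases hcase with h | h
  · have : eqw u a p (N' + 1) := by
      intro i hi
      rcases Nat.eq_zero_or_pos i with rfl | h1
      · simpa using h
      · exact hae' i h1 hi
    refine no_pal hc hr (p := q) (q := p) hN hne.symm (fun i h1 h2 => (heq i h1 h2).symm) hqN ?_
      (ha.congr this)
    intro i h1 h2
    rw [← heq i h1 h2, ← heq (N' + 1 - i) (by omega) (by omega)]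
    exact hpal i h1 h2
  · have : eqw u a q (N' + 1) := by
      intro i hi
      rcases Nat.eq_zero_or_pos i with rfl | h1
      · simpa using h
      · rw [hae' i h1 hi, heq i h1 hi]
    exact no_pal hc hr hN hne heq hpN hpal (ha.congr this)

lemma cnt_unbdd (K : ℕ) : ∃ N : ℕ, (K : ℤ) ≤ cnt u 0 N := by
  -- a position carrying a one
  obtain ⟨z, hz⟩ : ∃ z, u z = 1 := by
    obtain ⟨a, b, -, hne⟩ := special_exists hc 0
    simp only [Nat.cast_zero, add_zero] at hne
    by_cases h : u a = 1
    · exact ⟨a, h⟩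
    · exact ⟨b, by omega⟩
  induction K with
  | zero => exact ⟨0, by simp [cnt]⟩
  | succ K ih =>
    obtain ⟨N, hN⟩ := ih
    obtain ⟨b, hb, hbe⟩ := hr z 1 N
    have h1 := hbe 0 (by omega)
    simp only [Nat.cast_zero, add_zero] at h1
    obtain ⟨t, ht⟩ := Int.le.dest hb
    refine ⟨N + t + 1, ?_⟩
    have hmono : cnt u 0 N ≤ cnt u 0 (N + t) := by
      unfold cnt
      exact Finset.sum_le_sum_of_subset_of_nonneg
        (Finset.range_mono (by omega)) (fun i _ _ => by positivity)
    have : cnt u 0 (N + t + 1) = cnt u 0 (N + t) + 1 := by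
      unfold cnt
      rw [Finset.sum_range_succ]
      push_cast
      rw [zero_add, ht, ← h1, hz]
      rfl
    push_cast
    omega

omit hr in
lemma affine_rep (M : ℕ) (H : (Fin M → Fin 2) → ℝ) : ∃ (c : ℝ) (a : Fin M → ℝ),
    ∀ k : ℤ, H (wd u M k) = c + ∑ i, a i * ((wd u M k i).val : ℝ) := by
  let W := Set.range (wd u M)
  have : Fintype W := Fintype.ofFinite W
  let Φ : (ℝ × (Fin M → ℝ)) →ₗ[ℝ] (W → ℝ) :=
    { toFun := fun x w => x.1 + ∑ i, x.2 i * ((w.1 i).val : ℝ)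
      map_add' := by
        intro x y; funext w
        simp only [Prod.fst_add, Prod.snd_add, Pi.add_apply, add_mul, Finset.sum_add_distrib]
        ring
      map_smul' := by
        intro r x; funext w
        simp only [Prod.smul_fst, Prod.smul_snd, Pi.smul_apply, smul_eq_mul, RingHom.id_apply,
          mul_add, Finset.mul_sum, mul_assoc] }
  have hfin : Module.finrank ℝ (ℝ × (Fin M → ℝ)) = Module.finrank ℝ (W → ℝ) := by
    rw [Module.finrank_prod, Module.finrank_self, Module.finrank_fin_fun, Module.finrank_pi,
      ← Nat.card_eq_fintype_card, Nat.card_coe_set_eq, hc]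
    omega
  have hinj : Function.Injective Φ := by
    rw [injective_iff_map_eq_zero]
    rintro ⟨c, a⟩ h
    have hk : ∀ k : ℤ, c + ∑ i : Fin M, a i * ((u (k + (i : ℕ))).val : ℝ) = 0 := by
      intro k
      exact congrFun h ⟨wd u M k, k, rfl⟩
    have ha : a = 0 := by
      by_contra hne
      have hex : (Finset.univ.filter fun i => a i ≠ 0).Nonempty := by
        obtain ⟨i, hi⟩ := Function.ne_iff.1 hne
        exact ⟨i, by simpa using hi⟩
      set j := (Finset.univ.filter fun i => a i ≠ 0).max' hex with hj
      have hj0 : a j ≠ 0 := by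
        have := Finset.max'_mem _ hex
        rw [Finset.mem_filter] at this
        exact this.2
      have hjmax : ∀ i, j < i → a i = 0 := by
        intro i hi
        by_contra h0
        have := Finset.le_max' (Finset.univ.filter fun i => a i ≠ 0) i (by simpa using h0)
        exact absurd hi (not_lt.2 this)
      obtain ⟨p, q, he, hd⟩ := special_exists hc (j : ℕ)
      have h1 := hk p
      have h2 := hk q
      have h3 : ∑ i : Fin M, (a i * ((u (p + (i : ℕ))).val : ℝ) - a i * ((u (q + (i : ℕ))).val : ℝ))
          = 0 := by
        rw [Finset.sum_sub_distrib]; linarith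
      rw [Finset.sum_eq_single j] at h3
      · rw [← mul_sub] at h3
        rcases mul_eq_zero.1 h3 with h4 | h4
        · exact hj0 h4
        · apply hd
          apply Fin.ext
          exact_mod_cast sub_eq_zero.1 h4
      · intro i _ hij
        rcases lt_or_gt_of_ne hij with h4 | h4
        · rw [he i h4]; simp
        · rw [hjmax i h4]; simp
      · simp
    subst ha
    have := hk 0
    simp at this
    simp [this]
  have hsurj := (LinearMap.injective_iff_surjective_of_finrank_eq_finrank hfin).1 hinj
  obtain ⟨⟨c, a⟩, hx⟩ := hsurj (fun w => H w.1)
  refine ⟨c, a, fun k => ?_⟩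
  exact (congrFun hx ⟨wd u M k, k, rfl⟩).symm

end

/-- windows of points in the orbit closure occur in `u` -/
lemma window_of_mem {x : ℤ → Fin 2} {S : Set (ℤ → Fin 2)} (hx : x ∈ closure S) (k : ℤ) (M : ℕ) :
    ∃ y ∈ S, ∀ i : ℕ, i < M → y (k + i) = x (k + i) := by
  have hopen : IsOpen (⋂ i ∈ Finset.range M, {y : ℤ → Fin 2 | y (k + i) = x (k + i)}) := by
    refine isOpen_biInter_finset fun i _ => ?_
    exact isOpen_discrete {x (k + (i : ℤ))} |>.preimage
      (continuous_apply (A := fun _ : ℤ => Fin 2) (k + (i : ℤ)))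
  obtain ⟨y, hy, hyS⟩ := mem_closure_iff.1 hx _ hopen (by simp)
  refine ⟨y, hyS, fun i hi => ?_⟩
  simp only [Set.mem_iInter] at hy
  exact hy i (Finset.mem_range.2 hi)

/-- **Sturmian subshifts are topologically simple.**  Let `u ∈ {0,1}^ℤ` be a Sturmian
word: `u` is recurrent under the shift `σ` and for every `n ≥ 1` the number of distinct
words of length `n` occurring in `u` equals `n + 1`.  Let `X_u` be the closure of the
shift-orbit of `u`.  Then there exists `f ∈ C(X_u)` whose iterates `f ∘ σⁿ`, `n ∈ ℤ`,
span a dense subspace of `C(X_u)`. -/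
theorem sturmian_topologically_simple
    (u : ℤ → Fin 2)
    (hrec : u ∈ closure {x : ℤ → Fin 2 | ∃ n : ℕ, 1 ≤ n ∧ x = shiftZ (Fin 2) n u})
    (hcomp : ∀ n : ℕ, 1 ≤ n →
      {w : Fin n → Fin 2 | ∃ k : ℤ, ∀ i : Fin n, u (k + i) = w i}.ncard = n + 1) :
    ∃ f : C(↥(orbitClosure u), ℝ),
      Dense (Submodule.span ℝ
        {h : C(↥(orbitClosure u), ℝ) | ∃ n : ℤ, ∀ y : ↥(orbitClosure u),
          h y = f ⟨shiftZ (Fin 2) n y.1, shiftZ_mem_orbitClosure u n y.2⟩} :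
        Set C(↥(orbitClosure u), ℝ)) := by
  have hc : ∀ n, (Set.range (wd u n)).ncard = n + 1 := by
    intro n
    rcases Nat.eq_zero_or_pos n with rfl | hn
    · have : Set.range (wd u 0) = {wd u 0 0} := by
        ext w
        constructor
        · rintro ⟨a, rfl⟩
          exact Subsingleton.elim _ _
        · rintro rfl
          exact ⟨0, rfl⟩
      rw [this, Set.ncard_singleton]
    · rw [← hcomp n hn]
      congr 1
      ext w
      constructor
      · rintro ⟨k, rfl⟩
        exact ⟨k, fun i => rfl⟩
      · rintro ⟨k, hk⟩
        exact ⟨k, funext hk⟩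
  have hr : ∀ (a : ℤ) (N : ℕ) (B : ℤ), ∃ b, B ≤ b ∧ eqw u a b N := by
    intro a N B
    have key : ∀ t : ℕ, ∃ b, a + t ≤ b ∧ eqw u a b N := by
      intro t
      induction t with
      | zero => exact ⟨a, by simp, fun _ _ => rfl⟩
      | succ t ih =>
        obtain ⟨b, hb, he⟩ := ih
        obtain ⟨y, ⟨n, hn, rfl⟩, hy⟩ := window_of_mem hrec b N
        refine ⟨b + n, by push_cast; omega, fun i hi => ?_⟩
        rw [he i hi, ← hy i hi]
        change u (b + i + n) = _
        congr 1; ring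
    obtain ⟨b, hb, he⟩ := key (B - a).toNat
    exact ⟨b, by omega, he⟩
  have hwin : ∀ (x : orbitClosure u) (k : ℤ) (M : ℕ), ∃ a : ℤ, ∀ i : ℕ, i < M →
      x.1 (k + i) = u (a + i) := by
    intro x k M
    obtain ⟨y, ⟨n, rfl⟩, hy⟩ := window_of_mem x.2 k M
    refine ⟨k + n, fun i hi => ?_⟩
    rw [← hy i hi]
    change u (k + i + n) = _
    congr 1; ring
  have : CompactSpace (orbitClosure u) :=
    isCompact_iff_compactSpace.1 (isClosed_closure.isCompact)
  let co : ℤ → C(orbitClosure u, ℝ) := fun n =>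
    ⟨fun y => ((y.1 n).val : ℝ), by
      have h1 : Continuous (fun a : Fin 2 => (a.val : ℝ)) := continuous_of_discreteTopology
      exact h1.comp ((continuous_apply n).comp continuous_subtype_val)⟩
  refine ⟨co 0, ?_⟩
  set V := Submodule.span ℝ
        {h : C(↥(orbitClosure u), ℝ) | ∃ n : ℤ, ∀ y : ↥(orbitClosure u),
          h y = co 0 ⟨shiftZ (Fin 2) n y.1, shiftZ_mem_orbitClosure u n y.2⟩} with hV
  have hco : ∀ n, co n ∈ V := by
    intro n
    apply Submodule.subset_span
    refine ⟨n, fun y => ?_⟩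
    change ((y.1 n).val : ℝ) = ((y.1 (0 + n)).val : ℝ)
    rw [zero_add]
  have hone : (1 : C(orbitClosure u, ℝ)) ∈ V.topologicalClosure := by
    change (1 : C(orbitClosure u, ℝ)) ∈ closure (V : Set C(orbitClosure u, ℝ))
    rw [Metric.mem_closure_iff]
    intro ε hε
    obtain ⟨K, hK⟩ := exists_nat_gt (1 / ε)
    obtain ⟨N, hN⟩ := cnt_unbdd hc hr (K + 1)
    set s : ℝ := (cnt u 0 N : ℝ) with hs
    have hsK : (K : ℝ) + 1 ≤ s := by rw [hs]; exact_mod_cast hN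
    have hs0 : 0 < s := by have : (0 : ℝ) ≤ K := Nat.cast_nonneg K; linarith
    refine ⟨s⁻¹ • ∑ i ∈ Finset.range N, co i,
      V.smul_mem _ (V.sum_mem fun i _ => hco i), ?_⟩
    rw [ContinuousMap.dist_lt_iff hε]
    intro x
    obtain ⟨a, ha⟩ := hwin x 0 N
    have hx : (∑ i ∈ Finset.range N, co i) x = (cnt u a N : ℝ) := by
      rw [ContinuousMap.sum_apply]
      unfold cnt
      push_cast
      refine Finset.sum_congr rfl fun i hi => ?_
      have := ha i (Finset.mem_range.1 hi)
      rw [zero_add] at this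
      change ((x.1 i).val : ℝ) = _
      rw [this]
    have b1 : (cnt u a N : ℝ) ≤ s + 1 := by rw [hs]; exact_mod_cast balanced hc hr N a 0
    have b2 : s ≤ (cnt u a N : ℝ) + 1 := by rw [hs]; exact_mod_cast balanced hc hr N 0 a
    rw [ContinuousMap.smul_apply, hx, ContinuousMap.one_apply, Real.dist_eq, smul_eq_mul]
    have e : 1 - s⁻¹ * (cnt u a N : ℝ) = s⁻¹ * (s - cnt u a N) := by
      field_simp
    rw [e, abs_mul, abs_of_pos (inv_pos.2 hs0)]
    have h1 : |s - (cnt u a N : ℝ)| ≤ 1 := abs_le.2 ⟨by linarith, by linarith⟩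
    have h2 : 1 / ε < s := by linarith
    calc s⁻¹ * |s - (cnt u a N : ℝ)| ≤ s⁻¹ * 1 := by gcongr
      _ = 1 / s := by rw [mul_one, one_div]
      _ < ε := by
        rw [div_lt_iff₀ hε] at h2
        rw [div_lt_iff₀ hs0]; linarith
  -- locally constant functions
  have hloc : ∀ (g : C(orbitClosure u, ℝ)) (k : ℤ) (M : ℕ),
      (∀ x y : orbitClosure u, (∀ i : ℕ, i < M → x.1 (k + i) = y.1 (k + i)) → g x = g y) →
      g ∈ V.topologicalClosure := by
    intro g k M hg
    have hub : ∀ a : ℤ, shiftZ (Fin 2) a u ∈ orbitClosure u := fun a => subset_closure ⟨a, rfl⟩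
    let H : (Fin M → Fin 2) → ℝ := fun w => by
      classical
      exact if h : ∃ a, wd u M a = w then g ⟨shiftZ (Fin 2) (h.choose - k) u, hub _⟩ else 0
    have hH : ∀ (x : orbitClosure u) (a : ℤ), (∀ i : ℕ, i < M → x.1 (k + i) = u (a + i)) →
        g x = H (wd u M a) := by
      intro x a hxa
      have hex : ∃ a', wd u M a' = wd u M a := ⟨a, rfl⟩
      have : H (wd u M a) = g ⟨shiftZ (Fin 2) (hex.choose - k) u, hub _⟩ := by
        simp only [H]
        rw [dif_pos hex]
      rw [this]
      apply hg
      intro i hi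
      rw [hxa i hi]
      have h2 := (wd_eq_iff _ _ _ _).1 hex.choose_spec i hi
      rw [← h2]
      change _ = u (k + i + (hex.choose - k))
      congr 1; ring
    obtain ⟨c, a, hca⟩ := affine_rep hc M H
    have hgeq : g = c • (1 : C(orbitClosure u, ℝ)) + ∑ i : Fin M, a i • co (k + (i : ℕ)) := by
      ext x
      obtain ⟨b, hb⟩ := hwin x k M
      rw [hH x b hb, hca, ContinuousMap.add_apply, ContinuousMap.smul_apply,
        ContinuousMap.sum_apply, ContinuousMap.one_apply, smul_eq_mul, mul_one]
      congr 1
      refine Finset.sum_congr rfl fun i _ => ?_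
      rw [ContinuousMap.smul_apply, smul_eq_mul]
      congr 1
      change ((u (b + (i : ℕ))).val : ℝ) = ((x.1 (k + (i : ℕ))).val : ℝ)
      rw [hb i i.2]
    rw [hgeq]
    refine Submodule.add_mem _ (Submodule.smul_mem _ _ hone) (Submodule.sum_mem _ fun i _ => ?_)
    exact Submodule.smul_mem _ _ (V.le_topologicalClosure (hco _))
  let A : Subalgebra ℝ C(orbitClosure u, ℝ) := Algebra.adjoin ℝ (Set.range co)
  have hA : ∀ g ∈ A, ∃ K : ℕ, ∀ x y : orbitClosure u,
      (∀ n : ℤ, -K ≤ n → n ≤ K → x.1 n = y.1 n) → g x = g y := by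
    intro g hg
    induction hg using Algebra.adjoin_induction with
    | mem g hg =>
      obtain ⟨n, rfl⟩ := hg
      refine ⟨n.natAbs, fun x y h => ?_⟩
      change ((x.1 n).val : ℝ) = ((y.1 n).val : ℝ)
      rw [h n (by omega) (by omega)]
    | algebraMap r => exact ⟨0, fun x y _ => rfl⟩
    | add f g _ _ hf hg =>
      obtain ⟨K, hK⟩ := hf
      obtain ⟨L, hL⟩ := hg
      refine ⟨K + L, fun x y h => ?_⟩
      rw [ContinuousMap.add_apply, ContinuousMap.add_apply,
        hK x y fun n h1 h2 => h n (by push_cast; omega) (by push_cast; omega),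
        hL x y fun n h1 h2 => h n (by push_cast; omega) (by push_cast; omega)]
    | mul f g _ _ hf hg =>
      obtain ⟨K, hK⟩ := hf
      obtain ⟨L, hL⟩ := hg
      refine ⟨K + L, fun x y h => ?_⟩
      rw [ContinuousMap.mul_apply, ContinuousMap.mul_apply,
        hK x y fun n h1 h2 => h n (by push_cast; omega) (by push_cast; omega),
        hL x y fun n h1 h2 => h n (by push_cast; omega) (by push_cast; omega)]
  have hAV : (A : Set C(orbitClosure u, ℝ)) ⊆ closure (V : Set C(orbitClosure u, ℝ)) := by
    intro g hg
    obtain ⟨K, hK⟩ := hA g hg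
    refine hloc g (-K) (2 * K + 1) fun x y h => hK x y fun n h1 h2 => ?_
    have := h (n + K).toNat (by omega)
    have e : -(K : ℤ) + ((n + K).toNat : ℤ) = n := by omega
    rwa [e] at this
  have hsep : A.SeparatesPoints := by
    intro x y hxy
    have : ∃ n, x.1 n ≠ y.1 n := by
      by_contra hno
      push Not at hno
      exact hxy (Subtype.ext (funext hno))
    obtain ⟨n, hn⟩ := this
    refine ⟨co n, ⟨co n, Algebra.subset_adjoin ⟨n, rfl⟩, rfl⟩, ?_⟩
    intro h
    apply hn
    apply Fin.ext
    have h' : ((x.1 n).val : ℝ) = ((y.1 n).val : ℝ) := h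
    exact_mod_cast h'
  have htop := ContinuousMap.subalgebra_topologicalClosure_eq_top_of_separatesPoints A hsep
  intro g
  have hg : g ∈ A.topologicalClosure := by rw [htop]; trivial
  exact closure_minimal hAV isClosed_closure hg
end
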